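/- arXiv:1207.3132 — 9 statements merged into one kernel-verified Lean document; each statement's English description precedes it below -/
import Mathlib

section
/- Let p be a prime, let m > 1, and let G be a subgroup of the group of permutations of ZMod p^m that contains the translation T. If p^s is the order of a Sylow p-subgroup of G (equivalently, p^s is the p-part of the order of G), then m ≤ s ≤ p^{m−1} + p^{m−2} + ⋯ + p + 1 = (p^m − 1)/(p − 1). -/
theorem padicValNat_factorial_prime_pow (p : ℕ) [Fact p.Prime] (m : ℕ) :
    padicValNat p (p ^ m).factorial = ∑ i ∈ Finset.range m, p ^ i := by
  induction m with
  | zero => simp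
  | succ k ih => rw [pow_succ', padicValNat_factorial_mul, ih, Finset.sum_range_succ]

theorem orderOf_addRight_one (n : ℕ) : orderOf (Equiv.addRight (1 : ZMod n)) = n := by
  refine Nat.dvd_right_iff_eq.mp fun k => ?_
  rw [orderOf_dvd_iff_pow_eq_one, Equiv.ext_iff, ← ZMod.natCast_eq_zero_iff]
  simp

/-- For a prime `p`, `m > 1`, and a subgroup `G` of the permutations of `ZMod (p^m)`
containing the translation `T : x ↦ x + 1`, if `p^s` is the order of a Sylow `p`-subgroup
of `G`, then `m ≤ s ≤ p^(m-1) + ⋯ + p + 1`. -/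
theorem stmt_1 (p m : ℕ) (hp : p.Prime) (hm : 1 < m)
    (G : Subgroup (Equiv.Perm (ZMod (p ^ m))))
    (hT : Equiv.addRight (1 : ZMod (p ^ m)) ∈ G)
    (P : Sylow p G) (s : ℕ) (hs : Nat.card P.toSubgroup = p ^ s) :
    m ≤ s ∧ s ≤ ∑ i ∈ Finset.range m, p ^ i := by
  have : Fact p.Prime := ⟨hp⟩
  have : NeZero (p ^ m) := ⟨pow_ne_zero m hp.ne_zero⟩
  constructor
  · have hG : p ^ m ∣ Nat.card G := by
      have h := Subgroup.orderOf_dvd_natCard G hT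
      rwa [orderOf_addRight_one] at h
    have hP := P.pow_dvd_card_of_pow_dvd_card hG
    rw [hs] at hP
    exact (Nat.pow_dvd_pow_iff_le_right hp.one_lt).mp hP
  · rw [← padicValNat_factorial_prime_pow, ← padicValNat_dvd_iff_le (Nat.factorial_ne_zero _), ← hs]
    have hG := P.toSubgroup.card_subgroup_dvd_card.trans G.card_subgroup_dvd_card
    rwa [Nat.card_perm, Nat.card_zmod] at hG
end

section
/- Let F be a finite field of cardinality q, let n be a positive integer with gcd(q, n) = 1, and let C be a cyclic code of length n over F. Then the multiplier μ_q (the permutation x ↦ q·x of ZMod n, where q is cast into ZMod n and is a unit) belongs to Aut(C). -/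
/-- The action of a permutation `σ` of `ZMod n` on words: `(σ · c)(i) = c (σ⁻¹ i)`. -/
def permAction {F : Type*} {n : ℕ} (σ : Equiv.Perm (ZMod n)) (c : ZMod n → F) : ZMod n → F :=
  fun i => c (σ⁻¹ i)

/-- A cyclic code of length `n` over `F`: a linear code closed under the cyclic shift. -/
def IsCyclicCode {F : Type*} [Field F] {n : ℕ} (C : Submodule F (ZMod n → F)) : Prop :=
  ∀ c ∈ C, (fun i => c (i - 1)) ∈ C

/-- The automorphism group of a code: all permutations `σ` with `σ · C = C`. -/
def autCode {F : Type*} [Field F] {n : ℕ} (C : Submodule F (ZMod n → F)) :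
    Subgroup (Equiv.Perm (ZMod n)) where
  carrier := {σ | ∀ c : ZMod n → F, permAction σ c ∈ C ↔ c ∈ C}
  one_mem' := by
    intro c
    have h : permAction (1 : Equiv.Perm (ZMod n)) c = c := by
      funext i; simp [permAction]
    rw [h]
  mul_mem' := by
    intro σ τ hσ hτ c
    have h : permAction (σ * τ) c = permAction σ (permAction τ c) := by
      funext i; simp [permAction]
    rw [h, hσ, hτ]
  inv_mem' := by
    intro σ hσ c
    have h1 : permAction σ (permAction σ⁻¹ c) = c := by
      funext i; simp [permAction]
    have h2 := hσ (permAction σ⁻¹ c)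
    rw [h1] at h2
    exact h2.symm

/-- The multiplier permutation `μ_u : x ↦ u * x` for a unit `u` of `ZMod n`. -/
def multPerm {n : ℕ} (u : (ZMod n)ˣ) : Equiv.Perm (ZMod n) where
  toFun x := (u : ZMod n) * x
  invFun x := ((u⁻¹ : (ZMod n)ˣ) : ZMod n) * x
  left_inv x := by simp [← mul_assoc]
  right_inv x := by simp [← mul_assoc]

/-- The cyclic shift of words as a linear endomorphism. -/
def shiftEnd (F : Type*) [Field F] (n : ℕ) : Module.End F (ZMod n → F) :=
  LinearMap.funLeft F F fun i => i - 1

lemma shiftEnd_pow_apply {F : Type*} [Field F] {n : ℕ} (k : ℕ) (c : ZMod n → F) (j : ZMod n) :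
    (shiftEnd F n ^ k) c j = c (j - k) := by
  induction k generalizing j with
  | zero => simp
  | succ k ih =>
    rw [pow_succ', Module.End.mul_apply]
    change (shiftEnd F n ^ k) c (j - 1) = _
    rw [ih]
    congr 1
    push_cast
    ring

/-- The polynomial `∑ c i * X ^ i` attached to a word `c`. -/
noncomputable def wordPolynomial {F : Type*} [Field F] {n : ℕ} [NeZero n] (c : ZMod n → F) :
    Polynomial F :=
  ∑ i : ZMod n, Polynomial.monomial i.val (c i)

lemma aeval_shiftEnd_pow_wordPolynomial {F : Type*} [Field F] {n : ℕ} [NeZero n]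
    (c : ZMod n → F) (u : (ZMod n)ˣ) (m : ℕ) (hm : (m : ZMod n) = u) :
    Polynomial.aeval (shiftEnd F n ^ m) (wordPolynomial c) (Pi.single 0 1) =
      permAction (multPerm u) c := by
  funext j
  have hsum : ∀ i : ZMod n, i ≠ ((u⁻¹ : (ZMod n)ˣ) : ZMod n) * j →
      c i * (Pi.single 0 1 : ZMod n → F) (j - (u : ZMod n) * i) = 0 := by
    intro i hi
    rw [Pi.single_eq_of_ne, mul_zero]
    intro h
    apply hi
    rw [sub_eq_zero.mp h, Units.inv_mul_cancel_left]
  simp only [wordPolynomial, map_sum, Polynomial.aeval_monomial, LinearMap.sum_apply,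
    Finset.sum_apply, Module.End.mul_apply, Module.algebraMap_end_apply, Pi.smul_apply,
    ← pow_mul, shiftEnd_pow_apply, smul_eq_mul, Nat.cast_mul, ZMod.natCast_zmod_val, hm]
  rw [Fintype.sum_eq_single _ hsum, Units.mul_inv_cancel_left, sub_self, Pi.single_eq_same,
    mul_one]
  rfl

lemma IsCyclicCode.aeval_shiftEnd_mem {F : Type*} [Field F] {n : ℕ}
    {C : Submodule F (ZMod n → F)} (hC : IsCyclicCode C) (f : Polynomial F)
    {c : ZMod n → F} (hc : c ∈ C) : Polynomial.aeval (shiftEnd F n) f c ∈ C := by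
  induction f using Polynomial.induction_on' with
  | add p q hp hq => simpa using C.add_mem hp hq
  | monomial k a =>
    rw [Polynomial.aeval_monomial, Module.End.mul_apply, Module.algebraMap_end_apply]
    refine C.smul_mem a ?_
    induction k with
    | zero => simpa using hc
    | succ k ih =>
      rw [pow_succ']
      exact hC _ ih

/-- A permutation of `ZMod n` mapping a code into itself is an automorphism of the code. -/
lemma mem_autCode_of_forall_mem {F : Type*} [Field F] {n : ℕ} [NeZero n]
    {C : Submodule F (ZMod n → F)} {σ : Equiv.Perm (ZMod n)}
    (h : ∀ c ∈ C, permAction σ c ∈ C) : σ ∈ autCode C := by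
  have hpow : ∀ k : ℕ, ∀ c ∈ C, permAction (σ ^ k) c ∈ C := by
    intro k
    induction k with
    | zero => exact fun c hc => hc
    | succ k ih =>
      intro c hc
      rw [pow_succ]
      exact ih _ (h c hc)
  intro c
  refine ⟨fun hc => ?_, h c⟩
  have hmem := hpow (orderOf σ - 1) _ hc
  have hone : σ ^ (orderOf σ - 1) * σ = 1 := by
    rw [← pow_succ, Nat.sub_add_cancel (orderOf_pos σ), pow_orderOf_eq_one]
  change permAction (σ ^ (orderOf σ - 1) * σ) c ∈ C at hmem
  rwa [hone] at hmem

/-- For a cyclic code `C` of length `n` over a finite field of cardinality `q` with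
`gcd(q, n) = 1`, the multiplier `μ_q : x ↦ q x` belongs to `Aut(C)`. -/
theorem stmt_2 (F : Type*) [Field F] [Fintype F] (q n : ℕ) (hn : 0 < n)
    (hq : Fintype.card F = q) (hco : Nat.Coprime q n)
    (C : Submodule F (ZMod n → F)) (hC : IsCyclicCode C) :
    multPerm (ZMod.unitOfCoprime q hco) ∈ autCode C := by
  subst hq
  have : NeZero n := ⟨hn.ne'⟩
  refine mem_autCode_of_forall_mem fun c hc => ?_
  have hword : Polynomial.aeval (shiftEnd F n) (wordPolynomial c) (Pi.single 0 1) = c := by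
    have h := aeval_shiftEnd_pow_wordPolynomial c 1 1 (by simp)
    rw [pow_one] at h
    rw [h]
    funext j
    change c (((1⁻¹ : (ZMod n)ˣ) : ZMod n) * j) = c j
    simp
  rw [← aeval_shiftEnd_pow_wordPolynomial c _ (Fintype.card F) (ZMod.coe_unitOfCoprime _ hco).symm,
    ← Polynomial.expand_aeval, FiniteField.expand_card,
    ← Nat.sub_add_cancel (Fintype.card_pos (α := F)), pow_succ, map_mul, Module.End.mul_apply,
    hword]
  exact hC.aeval_shiftEnd_mem _ hc
end

section
/- Let n be a positive integer and let a be a unit of ZMod n. In the group of permutations of ZMod n, the subgroup generated by the translation T (T(x) = x + 1) and the multiplier μ_a (μ_a(x) = a·x) has cardinality n times the multiplicative order of a in (ZMod n)ˣ. -/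
theorem multPerm_apply {n : ℕ} (u : (ZMod n)ˣ) (x : ZMod n) : multPerm u x = u * x := rfl

/-- The multiplier permutations as a homomorphism from the units of `ZMod n`. -/
def multPermHom (n : ℕ) : (ZMod n)ˣ →* Equiv.Perm (ZMod n) :=
  MonoidHom.mk' multPerm fun u v => by
    ext x
    simp [multPerm_apply, mul_assoc]

theorem multPermHom_apply {n : ℕ} (u : (ZMod n)ˣ) : multPermHom n u = multPerm u := rfl

/-- The affine permutation `x ↦ u * x + b` of `ZMod n`. -/
def affinePerm {n : ℕ} (b : ZMod n) (u : (ZMod n)ˣ) : Equiv.Perm (ZMod n) :=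
  Equiv.addRight b * multPerm u

theorem affinePerm_apply {n : ℕ} (b : ZMod n) (u : (ZMod n)ˣ) (x : ZMod n) :
    affinePerm b u x = u * x + b := rfl

theorem affinePerm_injective {n : ℕ} {b c : ZMod n} {u v : (ZMod n)ˣ}
    (h : affinePerm b u = affinePerm c v) : b = c ∧ u = v := by
  have hbc : b = c := by simpa [affinePerm_apply] using Equiv.congr_fun h 0
  subst hbc
  exact ⟨rfl, Units.ext (by simpa [affinePerm_apply] using Equiv.congr_fun h 1)⟩

theorem affinePerm_mul {n : ℕ} (b c : ZMod n) (u v : (ZMod n)ˣ) :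
    affinePerm b u * affinePerm c v = affinePerm ((u : ZMod n) * c + b) (u * v) := by
  ext x
  simp only [Equiv.Perm.mul_apply, affinePerm_apply, Units.val_mul]
  ring

theorem affinePerm_zero_one {n : ℕ} : affinePerm (0 : ZMod n) 1 = 1 := by
  ext x
  simp [affinePerm_apply]

theorem affinePerm_inv {n : ℕ} (b : ZMod n) (u : (ZMod n)ˣ) :
    (affinePerm b u)⁻¹ = affinePerm (-(((u⁻¹ : (ZMod n)ˣ) : ZMod n) * b)) u⁻¹ := by
  rw [inv_eq_iff_mul_eq_one, affinePerm_mul, ← affinePerm_zero_one]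
  simp

theorem addRight_one_pow {n : ℕ} (k : ℕ) :
    Equiv.addRight (1 : ZMod n) ^ k = Equiv.addRight (k : ZMod n) := by
  induction k with
  | zero => ext x; simp
  | succ k ih =>
    ext x
    rw [pow_succ, ih]
    simp only [Equiv.Perm.mul_apply, Equiv.coe_addRight]
    push_cast
    ring

/-- The subgroup generated by `T` and `μ_a` consists of the maps `x ↦ u * x + b` with `u` a power
of `a`. -/
theorem mem_closure_addRight_multPerm {n : ℕ} [NeZero n] {a : (ZMod n)ˣ}
    {g : Equiv.Perm (ZMod n)} :
    g ∈ Subgroup.closure {Equiv.addRight (1 : ZMod n), multPerm a} ↔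
      ∃ b, ∃ u ∈ Subgroup.zpowers a, affinePerm b u = g := by
  constructor
  · intro hg
    induction hg using Subgroup.closure_induction with
    | mem g hg =>
      rcases hg with rfl | rfl
      · exact ⟨1, 1, one_mem _, by ext x; simp [affinePerm_apply]⟩
      · exact ⟨0, a, Subgroup.mem_zpowers a, by ext x; simp [affinePerm_apply, multPerm_apply]⟩
    | one => exact ⟨0, 1, one_mem _, affinePerm_zero_one⟩
    | mul g h _ _ hg hh =>
      obtain ⟨b, u, hu, rfl⟩ := hg
      obtain ⟨c, v, hv, rfl⟩ := hh
      exact ⟨_, _, mul_mem hu hv, (affinePerm_mul b c u v).symm⟩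
    | inv g _ hg =>
      obtain ⟨b, u, hu, rfl⟩ := hg
      exact ⟨_, _, inv_mem hu, (affinePerm_inv b u).symm⟩
  · rintro ⟨b, u, ⟨k, rfl⟩, rfl⟩
    refine mul_mem ?_ ?_
    · have h : Equiv.addRight b = Equiv.addRight (1 : ZMod n) ^ b.val := by
        rw [addRight_one_pow, ZMod.natCast_zmod_val]
      rw [h]
      exact pow_mem (Subgroup.subset_closure (by simp)) _
    · change multPermHom n (a ^ k) ∈ _
      rw [map_zpow, multPermHom_apply]
      exact zpow_mem (Subgroup.subset_closure (by simp)) _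

/-- In the permutations of `ZMod n`, the subgroup generated by the translation
`T : x ↦ x + 1` and the multiplier `μ_a` has cardinality `n * orderOf a`. -/
theorem stmt_3 (n : ℕ) (hn : 0 < n) (a : (ZMod n)ˣ) :
    Nat.card (Subgroup.closure {Equiv.addRight (1 : ZMod n), multPerm a} :
      Subgroup (Equiv.Perm (ZMod n))) = n * orderOf a := by
  have : NeZero n := ⟨hn.ne'⟩
  let f : ZMod n × Subgroup.zpowers a → (Subgroup.closure {Equiv.addRight (1 : ZMod n), multPerm a} :
      Subgroup (Equiv.Perm (ZMod n))) := fun p =>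
    ⟨affinePerm p.1 p.2, mem_closure_addRight_multPerm.2 ⟨p.1, p.2, p.2.2, rfl⟩⟩
  have hf : Function.Bijective f := by
    constructor
    · intro p q h
      obtain ⟨hb, hu⟩ := affinePerm_injective (congrArg Subtype.val h)
      exact Prod.ext hb (Subtype.ext hu)
    · rintro ⟨g, hg⟩
      obtain ⟨b, u, hu, rfl⟩ := mem_closure_addRight_multPerm.1 hg
      exact ⟨(b, ⟨u, hu⟩), rfl⟩
  rw [← Nat.card_eq_of_bijective f hf, Nat.card_prod, Nat.card_zmod, Nat.card_zpowers]
end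

section
/- Let p be an odd prime, let m > 1, and let 1 ≤ n < p. Then the subgroup Q^n of the permutation group of ZMod p^m has cardinality (p − 1)·p^{2m+n−2}, and the subgroup Q_1^n has cardinality p^{m+n}. -/
/-- The set `Q^n ⊆ S_{p^m}`: permutations of `ZMod (p^m)` given by a polynomial
`f(x) = a₀ + a₁ x + ⋯ + aₙ xⁿ` with `a₁` a unit and `p^(m-1) ∣ aᵢ` for `2 ≤ i ≤ n`. -/
def QSet (p m n : ℕ) : Set (Equiv.Perm (ZMod (p ^ m))) :=
  {f | ∃ a : ℕ → ZMod (p ^ m),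
    (∀ x, f x = ∑ i ∈ Finset.range (n + 1), a i * x ^ i) ∧
    IsUnit (a 1) ∧
    ∀ i, 2 ≤ i → i ≤ n → ((p : ZMod (p ^ m)) ^ (m - 1)) ∣ a i}

/-- The set `Q₁^n ⊆ Q^n`: those polynomial permutations with `a₁ ≡ 1 (mod p^(m-1))`. -/
def Q1Set (p m n : ℕ) : Set (Equiv.Perm (ZMod (p ^ m))) :=
  {f | ∃ a : ℕ → ZMod (p ^ m),
    (∀ x, f x = ∑ i ∈ Finset.range (n + 1), a i * x ^ i) ∧
    IsUnit (a 1) ∧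
    ((p : ZMod (p ^ m)) ^ (m - 1)) ∣ (a 1 - 1) ∧
    ∀ i, 2 ≤ i → i ≤ n → ((p : ZMod (p ^ m)) ^ (m - 1)) ∣ a i}

/-- The affine group `AG(p^m)`: all permutations `x ↦ a x + b` of `ZMod (p^m)`
with `a` a unit. -/
def AGSet (p m : ℕ) : Set (Equiv.Perm (ZMod (p ^ m))) :=
  {f | ∃ a b : ZMod (p ^ m), IsUnit a ∧ ∀ x, f x = a * x + b}

/-- The polynomial function with coefficients `a 0, …, a n`. -/
def coeffEval {R : Type*} [CommRing R] {n : ℕ} (a : Fin (n + 1) → R) (x : R) : R :=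
  ∑ i, a i * x ^ (i : ℕ)

theorem isUnit_natCast_zmod_prime_pow {p m k : ℕ} (hp : p.Prime) (hk : 0 < k) (hkp : k < p) :
    IsUnit (k : ZMod (p ^ m)) := by
  rw [ZMod.isUnit_iff_coprime]
  exact ((Nat.coprime_of_lt_prime hk.ne' hkp hp).symm.pow_right m)

/-- Polynomial functions of degree less than `p` on `ZMod (p ^ m)` determine their coefficients,
since the Vandermonde matrix at `0, …, n` is invertible. -/
theorem coeffEval_injective {p m n : ℕ} (hp : p.Prime) (hnp : n < p) :
    Function.Injective (coeffEval : (Fin (n + 1) → ZMod (p ^ m)) → ZMod (p ^ m) → ZMod (p ^ m)) := by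
  intro a b hab
  let v : Fin (n + 1) → ZMod (p ^ m) := fun i => ((i : ℕ) : ZMod (p ^ m))
  have hV : IsUnit (Matrix.vandermonde v) := by
    rw [Matrix.isUnit_iff_isUnit_det, Matrix.det_vandermonde]
    refine IsUnit.prod_iff.2 fun i _ => IsUnit.prod_iff.2 fun j hj => ?_
    have hij : i.val < j.val := Fin.lt_def.1 (Finset.mem_Ioi.1 hj)
    have : v j - v i = ((j - i : ℕ) : ZMod (p ^ m)) := by
      rw [Nat.cast_sub hij.le]
    rw [this]
    exact isUnit_natCast_zmod_prime_pow hp (by omega) (by omega)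
  apply Matrix.mulVec_injective_of_isUnit hV
  ext i
  have := congrFun hab (v i)
  simpa [coeffEval, Matrix.mulVec, dotProduct, Matrix.vandermonde_apply, mul_comm] using this

theorem isUnit_add_of_prime_pow_dvd {p m : ℕ} (hm : 1 < m) {u y : ZMod (p ^ m)} (hu : IsUnit u)
    (hy : (p : ZMod (p ^ m)) ^ (m - 1) ∣ y) : IsUnit (u + y) := by
  have hnil : IsNilpotent y := by
    obtain ⟨c, rfl⟩ := hy
    refine (Commute.all _ _).isNilpotent_mul_right ⟨m, ?_⟩
    rw [← pow_mul, mul_comm, pow_mul, ← Nat.cast_pow, ZMod.natCast_self, zero_pow (by omega)]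
  exact hnil.isUnit_add_left_of_commute hu (Commute.all _ _)

theorem coeffEval_bijective {p m k : ℕ} (hp : p.Prime) (hm : 1 < m)
    {a : Fin (k + 2) → ZMod (p ^ m)} (h1 : IsUnit (a 1))
    (ha : ∀ i : Fin k, (p : ZMod (p ^ m)) ^ (m - 1) ∣ a i.succ.succ) :
    Function.Bijective (coeffEval a) := by
  have : NeZero (p ^ m) := ⟨pow_ne_zero _ hp.ne_zero⟩
  refine Finite.injective_iff_bijective.1 fun x y hxy => ?_
  have hd : (p : ZMod (p ^ m)) ^ (m - 1) * (x - y) ∣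
      ∑ i : Fin k, a i.succ.succ * (x ^ ((i : ℕ) + 2) - y ^ ((i : ℕ) + 2)) :=
    Finset.dvd_sum fun i _ => mul_dvd_mul (ha i) (sub_dvd_pow_sub_pow x y _)
  obtain ⟨c, hc⟩ := hd
  have key : coeffEval a x - coeffEval a y =
      (a 1 + (p : ZMod (p ^ m)) ^ (m - 1) * c) * (x - y) := by
    have e : ∀ z, coeffEval a z =
        a 0 + (a 1 * z + ∑ i : Fin k, a i.succ.succ * z ^ ((i : ℕ) + 2)) := by
      intro z
      simp [coeffEval, Fin.sum_univ_succ, add_assoc]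
    simp only [mul_sub, Finset.sum_sub_distrib] at hc
    rw [e, e]
    linear_combination hc
  rw [hxy, sub_self] at key
  exact sub_eq_zero.1
    ((isUnit_add_of_prime_pow_dvd hm h1 (Dvd.intro _ rfl)).mul_right_eq_zero.1 key.symm)

theorem card_prime_pow_dvd {p m : ℕ} (hp : p.Prime) (hm : 1 < m) :
    Nat.card {x : ZMod (p ^ m) | (p : ZMod (p ^ m)) ^ (m - 1) ∣ x} = p := by
  have : NeZero (p ^ m) := ⟨pow_ne_zero _ hp.ne_zero⟩
  have h : {x : ZMod (p ^ m) | (p : ZMod (p ^ m)) ^ (m - 1) ∣ x} =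
      (AddSubgroup.zmultiples (((p ^ (m - 1) : ℕ)) : ZMod (p ^ m)) : Set (ZMod (p ^ m))) := by
    ext x
    simp only [Set.mem_ofPred_eq, SetLike.mem_coe, AddSubgroup.mem_zmultiples_iff]
    constructor
    · rintro ⟨c, rfl⟩
      exact ⟨c.val, by simp [mul_comm]⟩
    · rintro ⟨c, rfl⟩
      exact ⟨c, by simp [mul_comm]⟩
  rw [h]
  refine (Nat.card_zmultiples _).trans ?_
  rw [ZMod.addOrderOf_coe _ this.out, Nat.gcd_eq_right (pow_dvd_pow p (Nat.sub_le m 1)),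
    Nat.pow_div (Nat.sub_le m 1) hp.pos, Nat.sub_sub_self hm.le, pow_one]

/-- The number of permutations of `ZMod (p ^ m)` given by polynomials of degree at most `k + 1`
whose linear coefficient lies in a set `U` of units and whose higher coefficients are divisible
by `p ^ (m - 1)`. -/
theorem card_polynomial_perm {p m k : ℕ} (hp : p.Prime) (hm : 1 < m) (hkp : k + 1 < p)
    (U : Set (ZMod (p ^ m))) (hU : ∀ u ∈ U, IsUnit u) :
    Nat.card {f : Equiv.Perm (ZMod (p ^ m)) | ∃ a : ℕ → ZMod (p ^ m),
      (∀ x, f x = ∑ i ∈ Finset.range (k + 1 + 1), a i * x ^ i) ∧ a 1 ∈ U ∧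
      ∀ i, 2 ≤ i → i ≤ k + 1 → ((p : ZMod (p ^ m)) ^ (m - 1)) ∣ a i} =
    p ^ m * (Nat.card U * p ^ k) := by
  let M : Set (ZMod (p ^ m)) := {x | (p : ZMod (p ^ m)) ^ (m - 1) ∣ x}
  let S : Fin (k + 2) → Set (ZMod (p ^ m)) := Fin.cons Set.univ (Fin.cons U fun _ => M)
  have hS : ∀ a : Fin (k + 2) → ZMod (p ^ m),
      a ∈ Set.univ.pi S ↔ a 1 ∈ U ∧ ∀ i : Fin k, a i.succ.succ ∈ M := by
    intro a
    simp [S, Fin.forall_fin_succ]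
  have hcard : Nat.card (Set.univ.pi S) = p ^ m * (Nat.card U * p ^ k) := by
    rw [Nat.card_congr (Equiv.Set.univPi S), Nat.card_pi, Fin.prod_univ_succ, Fin.prod_univ_succ]
    have hM : Nat.card M = p := card_prime_pow_dvd hp hm
    have h0 : Nat.card (Set.univ : Set (ZMod (p ^ m))) = p ^ m := by
      rw [Nat.card_univ, Nat.card_zmod]
    change Nat.card (Set.univ : Set (ZMod (p ^ m))) * (Nat.card U * ∏ _i : Fin k, Nat.card M) = _
    rw [h0, hM, Finset.prod_const, Finset.card_univ, Fintype.card_fin]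
  rw [← hcard, ← Nat.card_image_of_injective (coeffEval_injective hp hkp) (Set.univ.pi S),
    ← Nat.card_image_of_injective (DFunLike.coe_injective (F := Equiv.Perm (ZMod (p ^ m))))]
  congr 2
  ext g
  constructor
  · rintro ⟨f, ⟨a, hf, h1, ha⟩, rfl⟩
    refine ⟨fun i => a i, (hS _).2 ⟨by simpa using h1, fun i => ha _ ?_ ?_⟩, ?_⟩
    · simp
    · have := i.2
      simp only [Fin.val_succ]
      omega
    · funext x
      simp only [coeffEval, hf, Finset.sum_range]
  · rintro ⟨a, haS, rfl⟩
    obtain ⟨h1, ha⟩ := (hS a).1 haS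
    refine ⟨Equiv.ofBijective _ (coeffEval_bijective hp hm (hU _ h1) ha),
      ⟨fun i => if h : i < k + 2 then a ⟨i, h⟩ else 0, fun x => ?_, ?_, fun i hi hik => ?_⟩, rfl⟩
    · simp [coeffEval, Finset.sum_range]
    · simpa using h1
    · obtain ⟨j, rfl⟩ := Nat.exists_eq_add_of_le' hi
      beta_reduce
      rw [dif_pos (by omega)]
      exact ha ⟨j, by omega⟩

theorem card_isUnit_zmod_prime_pow {p m : ℕ} (hp : p.Prime) (hm : 0 < m) :
    Nat.card {x : ZMod (p ^ m) | IsUnit x} = p ^ (m - 1) * (p - 1) := by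
  have : NeZero (p ^ m) := ⟨pow_ne_zero _ hp.ne_zero⟩
  have h : {x : ZMod (p ^ m) | IsUnit x} = Set.range (Units.val : (ZMod (p ^ m))ˣ → ZMod (p ^ m)) :=
    rfl
  rw [h, Nat.card_range_of_injective Units.val_injective, Nat.card_eq_fintype_card,
    ZMod.card_units_eq_totient, Nat.totient_prime_pow hp hm]

theorem card_isUnit_prime_pow_dvd_sub_one {p m : ℕ} (hp : p.Prime) (hm : 1 < m) :
    Nat.card {x : ZMod (p ^ m) | IsUnit x ∧ (p : ZMod (p ^ m)) ^ (m - 1) ∣ x - 1} = p := by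
  have h : {x : ZMod (p ^ m) | IsUnit x ∧ (p : ZMod (p ^ m)) ^ (m - 1) ∣ x - 1} =
      (fun x => 1 + x) '' {x : ZMod (p ^ m) | (p : ZMod (p ^ m)) ^ (m - 1) ∣ x} := by
    ext x
    constructor
    · rintro ⟨-, hx⟩
      exact ⟨x - 1, hx, add_sub_cancel _ _⟩
    · rintro ⟨y, hy, rfl⟩
      exact ⟨isUnit_add_of_prime_pow_dvd hm isUnit_one hy, by simpa using hy⟩
  rw [h, Nat.card_image_of_injective (add_right_injective 1), card_prime_pow_dvd hp hm]

/-- For an odd prime `p`, `m > 1`, and `1 ≤ n < p`: `|Q^n| = (p-1) p^(2m+n-2)` and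
`|Q₁^n| = p^(m+n)`. -/
theorem stmt_5 (p m n : ℕ) (hp : p.Prime) (hodd : Odd p) (hm : 1 < m)
    (hn1 : 1 ≤ n) (hnp : n < p) :
    Nat.card (QSet p m n) = (p - 1) * p ^ (2 * m + n - 2) ∧
    Nat.card (Q1Set p m n) = p ^ (m + n) := by
  obtain ⟨k, rfl⟩ := Nat.exists_eq_add_of_le' hn1
  constructor
  · have h := card_polynomial_perm hp hm hnp {x | IsUnit x} fun _ hu => hu
    rw [card_isUnit_zmod_prime_pow hp (by omega)] at h
    refine Eq.trans h ?_
    rw [show 2 * m + (k + 1) - 2 = m + (m - 1) + k by omega, pow_add, pow_add]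
    ring
  · have h := card_polynomial_perm hp hm hnp
      {x | IsUnit x ∧ (p : ZMod (p ^ m)) ^ (m - 1) ∣ x - 1} fun _ hu => hu.1
    rw [card_isUnit_prime_pow_dvd_sub_one hp hm] at h
    simp only [Set.mem_ofPred_eq, and_assoc] at h
    refine Eq.trans h ?_
    ring
end

section
/- Let p be an odd prime, m > 1, and 1 ≤ n < p − 1. A permutation σ of ZMod p^m satisfies σ⁻¹ ∘ T ∘ σ ∈ Q_1^n if and only if σ ∈ Q^{n+1}; in other words, H(Q_1^n) = Q^{n+1}, where for a subgroup P of S_{p^m} one sets H(P) = {σ ∈ S_{p^m} : σ⁻¹ T σ ∈ P}. -/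
open Polynomial

section FiniteDifference

variable {R : Type*} [CommRing R]

theorem natDegree_X_add_C_pow_succ_sub_le (b : R) (k : ℕ) :
    ((X + C b) ^ (k + 1) - X ^ (k + 1) : R[X]).natDegree ≤ k := by
  refine natDegree_le_iff_coeff_eq_zero.2 fun j hj => ?_
  rw [coeff_sub, coeff_X_add_C_pow, coeff_X_pow]
  rcases Nat.lt_or_ge (k + 1) j with h | h
  · rw [Nat.choose_eq_zero_of_lt h, if_neg (by omega)]
    simp
  · obtain rfl : j = k + 1 := by omega
    simp

theorem natDegree_comp_X_add_C_sub_le (b : R) {k : ℕ} {h : R[X]} (hh : h.natDegree ≤ k + 1) :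
    (h.comp (X + C b) - h).natDegree ≤ k := by
  have key : h.comp (X + C b) - h =
      ∑ i ∈ Finset.range (k + 1 + 1), C (h.coeff i) * ((X + C b) ^ i - X ^ i) := by
    conv_lhs => rw [h.as_sum_range_C_mul_X_pow' (n := k + 1 + 1) (by omega)]
    simp [mul_sub]
  rw [key]
  refine natDegree_sum_le_of_forall_le _ _ fun i hi => (natDegree_C_mul_le _ _).trans ?_
  rcases i with _ | i
  · simp
  · exact (natDegree_X_add_C_pow_succ_sub_le b i).trans (by have := Finset.mem_range.1 hi; omega)

/-- Discrete antiderivatives: if the step `b` and the integers `1, …, n` are invertible, then every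
polynomial of degree less than `n` is a finite difference. -/
theorem exists_comp_X_add_C_sub_eq {b : R} (hb : IsUnit b) (n : ℕ)
    (hn : ∀ k < n, IsUnit ((k + 1 : ℕ) : R)) (g : R[X]) (hg : g.degree < n) :
    ∃ h : R[X], h.natDegree ≤ n ∧ h.comp (X + C b) - h = g := by
  induction n generalizing g with
  | zero =>
    refine ⟨0, by simp, ?_⟩
    have : g = 0 := by simpa using hg
    simp [this]
  | succ n ih =>
    obtain ⟨v, hv⟩ := (hb.mul (hn n n.lt_succ_self)).exists_right_inv
    set c := g.coeff n * v with hc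
    set d : R[X] := (X + C b) ^ (n + 1) - X ^ (n + 1) with hd
    have hdeg : (g - C c * d).degree < n := by
      rw [degree_lt_iff_coeff_zero] at hg ⊢
      intro j hj
      rcases hj.eq_or_lt with rfl | hj
      · have : d.coeff n = b * (n + 1 : ℕ) := by
          rw [hd, coeff_sub, coeff_X_add_C_pow, coeff_X_pow, if_neg (by omega)]
          simp [Nat.choose_succ_self_right]
        rw [coeff_sub, coeff_C_mul, this, hc]
        linear_combination -(g.coeff n) * hv
      · rw [coeff_sub, coeff_C_mul, hg j (by omega),
          natDegree_le_iff_coeff_eq_zero.1 (natDegree_X_add_C_pow_succ_sub_le b n) j hj]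
        simp
    obtain ⟨h, hh, hhg⟩ := ih (fun k hk => hn k (by omega)) _ hdeg
    refine ⟨h + C c * X ^ (n + 1), ?_, ?_⟩
    · exact natDegree_add_le_of_degree_le (by omega) (natDegree_C_mul_X_pow_le _ _)
    · simp only [add_comp, mul_comp, C_comp, pow_comp, X_comp]
      linear_combination hhg

theorem mul_eval_add_mul_of_mul_self_eq_zero {π : R} (hπ : π * π = 0) (h : R[X]) (x y : R) :
    π * h.eval (x + π * y) = π * h.eval x := by
  obtain ⟨w, hw⟩ := h.sub_dvd_eval_sub (x + π * y) x
  linear_combination π * hw + y * w * hπ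

theorem isUnit_add_mul_of_mul_self_eq_zero {π u : R} (hπ : π * π = 0) (hu : IsUnit u) (t : R) :
    IsUnit (u + π * t) := by
  obtain ⟨v, hv⟩ := hu.exists_right_inv
  refine .of_mul_eq_one (v - π * t * v * v) ?_
  linear_combination (1 - π * t * v) * hv - t * t * v * v * hπ

theorem sum_mul_pow_eq_add_mul_eval {n : ℕ} (hn : 1 ≤ n) {π : R} {a : ℕ → R}
    (ha : ∀ i, 2 ≤ i → i ≤ n → π ∣ a i) :
    ∃ h : R[X], h.natDegree ≤ n ∧
      ∀ x, ∑ i ∈ Finset.range (n + 1), a i * x ^ i = a 0 + a 1 * x + π * h.eval x := by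
  choose! q hq using ha
  refine ⟨∑ i ∈ Finset.Ico 2 (n + 1), C (q i) * X ^ i, ?_, fun x => ?_⟩
  · refine natDegree_sum_le_of_forall_le _ _ fun i hi => (natDegree_C_mul_X_pow_le _ _).trans ?_
    have := Finset.mem_Ico.1 hi
    omega
  · rw [← Finset.sum_range_add_sum_Ico _ (show 2 ≤ n + 1 by omega), Finset.sum_range_succ,
      Finset.sum_range_one, eval_finsetSum, Finset.mul_sum, pow_zero, mul_one, pow_one]
    congr 1
    refine Finset.sum_congr rfl fun i hi => ?_
    obtain ⟨h2, hi⟩ := Finset.mem_Ico.1 hi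
    rw [hq i h2 (by omega)]
    simp [mul_assoc]

theorem add_mul_eval_eq_sum_mul_pow {n : ℕ} (hn : 1 ≤ n) {π c u : R} {h : R[X]}
    (hh : h.natDegree ≤ n) :
    ∃ a : ℕ → R, a 1 = u + π * h.coeff 1 ∧ (∀ i, 2 ≤ i → π ∣ a i) ∧
      ∀ x, c + u * x + π * h.eval x = ∑ i ∈ Finset.range (n + 1), a i * x ^ i := by
  refine ⟨(C c + C u * X + C π * h).coeff, by simp [coeff_C], fun i hi => ?_, fun x => ?_⟩
  · rw [coeff_add, coeff_add, coeff_C_mul, coeff_C_mul, coeff_C, coeff_X, if_neg (by omega),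
      if_neg (by omega)]
    simp
  · rw [← eval_eq_sum_range' (n := n + 1)]
    · simp
    · refine Nat.lt_succ_of_le (natDegree_add_le_of_degree_le
        (natDegree_add_le_of_degree_le (by simp) ?_) ((natDegree_C_mul_le _ _).trans hh))
      exact (natDegree_C_mul_le _ _).trans (natDegree_X_le.trans hn)

end FiniteDifference

theorem ZMod.eq_apply_zero_of_forall_add_one {N : ℕ} [NeZero N] {A : Type*} {f : ZMod N → A}
    (hf : ∀ y, f (y + 1) = f y) (y : ZMod N) : f y = f 0 := by
  have key : ∀ k : ℕ, f k = f 0 := fun k => by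
    induction k with
    | zero => simp
    | succ k ih => rw [Nat.cast_succ, hf, ih]
  rw [← ZMod.natCast_zmod_val y, key]

theorem prime_pow_pred_mul_self_eq_zero (p : ℕ) {m : ℕ} (hm : 1 < m) :
    (p : ZMod (p ^ m)) ^ (m - 1) * (p : ZMod (p ^ m)) ^ (m - 1) = 0 := by
  rw [← pow_add, ← Nat.cast_pow, ZMod.natCast_eq_zero_iff]
  exact pow_dvd_pow p (by omega)

theorem mem_QSet_iff {p m n : ℕ} (hm : 1 < m) (hn : 1 ≤ n) {f : Equiv.Perm (ZMod (p ^ m))} :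
    f ∈ QSet p m n ↔ ∃ (c u : ZMod (p ^ m)) (h : (ZMod (p ^ m))[X]), IsUnit u ∧ h.natDegree ≤ n ∧
      ∀ x, f x = c + u * x + (p : ZMod (p ^ m)) ^ (m - 1) * h.eval x := by
  constructor
  · rintro ⟨a, hf, hu, ha⟩
    obtain ⟨h, hh, hs⟩ := sum_mul_pow_eq_add_mul_eval hn ha
    exact ⟨a 0, a 1, h, hu, hh, fun x => (hf x).trans (hs x)⟩
  · rintro ⟨c, u, h, hu, hh, hf⟩
    obtain ⟨a, ha1, ha, hs⟩ := add_mul_eval_eq_sum_mul_pow (c := c) (u := u) hn hh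
    refine ⟨a, fun x => (hf x).trans (hs x), ?_, fun i hi _ => ha i hi⟩
    rw [ha1]
    exact isUnit_add_mul_of_mul_self_eq_zero (prime_pow_pred_mul_self_eq_zero p hm) hu _

theorem mem_Q1Set_iff {p m n : ℕ} (hm : 1 < m) (hn : 1 ≤ n) {f : Equiv.Perm (ZMod (p ^ m))} :
    f ∈ Q1Set p m n ↔ ∃ (c : ZMod (p ^ m)) (h : (ZMod (p ^ m))[X]), h.natDegree ≤ n ∧
      ∀ x, f x = x + c + (p : ZMod (p ^ m)) ^ (m - 1) * h.eval x := by
  constructor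
  · rintro ⟨a, hf, -, ⟨t, ht⟩, ha⟩
    obtain ⟨h, hh, hs⟩ := sum_mul_pow_eq_add_mul_eval hn ha
    refine ⟨a 0, h + C t * X, natDegree_add_le_of_degree_le hh
      ((natDegree_C_mul_le _ _).trans (natDegree_X_le.trans hn)), fun x => ?_⟩
    rw [hf, hs]
    simp only [eval_add, eval_mul, eval_C, eval_X]
    linear_combination x * ht
  · rintro ⟨c, h, hh, hf⟩
    obtain ⟨a, ha1, ha, hs⟩ := add_mul_eval_eq_sum_mul_pow (c := c) (u := 1) hn hh
    refine ⟨a, fun x => ?_, ?_, ?_, fun i hi _ => ha i hi⟩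
    · rw [hf, ← hs]
      ring
    · rw [ha1]
      exact isUnit_add_mul_of_mul_self_eq_zero (prime_pow_pred_mul_self_eq_zero p hm) isUnit_one _
    · rw [ha1]
      exact ⟨h.coeff 1, by ring⟩

/-- The translation part of a map conjugate to `x ↦ x + 1` and congruent to a translation modulo
`p` is invertible. -/
theorem isUnit_of_conj_addRight_one {p m : ℕ} (hp : p.Prime) (hm : 1 < m)
    {σ τ : Equiv.Perm (ZMod (p ^ m))} (hστ : ∀ x, σ (τ x) = σ x + 1) {c : ZMod (p ^ m)}
    {g : ZMod (p ^ m) → ZMod (p ^ m)}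
    (hτ : ∀ x, τ x = x + c + (p : ZMod (p ^ m)) ^ (m - 1) * g x) : IsUnit c := by
  have : Fact p.Prime := ⟨hp⟩
  have : NeZero (p ^ m) := ⟨pow_ne_zero _ hp.ne_zero⟩
  by_contra hc
  let φ := ZMod.castHom (dvd_pow_self p (by omega : m ≠ 0)) (ZMod p)
  have hφc : φ c = 0 := by
    rw [← ZMod.natCast_zmod_val c] at hc ⊢
    rw [ZMod.isUnit_iff_coprime, Nat.coprime_pow_right_iff (by omega), Nat.coprime_comm,
      hp.coprime_iff_not_dvd, not_not] at hc
    rwa [map_natCast, ZMod.natCast_eq_zero_iff]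
  have hconst : ∀ y, φ (σ.symm y) = φ (σ.symm 0) :=
    ZMod.eq_apply_zero_of_forall_add_one fun y => by
      have hy : σ.symm (y + 1) = τ (σ.symm y) := by
        rw [Equiv.symm_apply_eq, hστ, Equiv.apply_symm_apply]
      rw [hy, hτ]
      simp [hφc, show m - 1 ≠ 0 by omega]
  have h01 := (hconst (σ 0)).trans (hconst (σ 1)).symm
  simp at h01

theorem conj_mem_Q1Set_of_mem_QSet {p m n : ℕ} (hm : 1 < m) (hn : 1 ≤ n)
    {σ : Equiv.Perm (ZMod (p ^ m))} (hσ : σ ∈ QSet p m (n + 1)) :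
    σ⁻¹ * Equiv.addRight (1 : ZMod (p ^ m)) * σ ∈ Q1Set p m n := by
  have hπ := prime_pow_pred_mul_self_eq_zero p hm
  obtain ⟨c, u, h, hu, hh, hσ⟩ := (mem_QSet_iff hm (by omega)).1 hσ
  obtain ⟨v, hv⟩ := hu.exists_right_inv
  refine (mem_Q1Set_iff hm hn).2 ⟨v, C (-v) * (h.comp (X + C v) - h),
    (natDegree_C_mul_le _ _).trans (natDegree_comp_X_add_C_sub_le v hh), fun x => ?_⟩
  rw [Equiv.Perm.mul_apply, Equiv.Perm.mul_apply, Equiv.Perm.inv_eq_iff_eq, Equiv.coe_addRight,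
    hσ, hσ, mul_eval_add_mul_of_mul_self_eq_zero hπ]
  simp only [eval_mul, eval_C, eval_sub, eval_comp, eval_add, eval_X]
  linear_combination (-1 + (p : ZMod (p ^ m)) ^ (m - 1) * (h.eval (x + v) - h.eval x)) * hv

theorem mem_QSet_of_conj_mem_Q1Set {p m n : ℕ} (hp : p.Prime) (hm : 1 < m) (hn : 1 ≤ n)
    (hnp : n < p - 1) {σ : Equiv.Perm (ZMod (p ^ m))}
    (hσ : σ⁻¹ * Equiv.addRight (1 : ZMod (p ^ m)) * σ ∈ Q1Set p m n) : σ ∈ QSet p m (n + 1) := by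
  have : NeZero (p ^ m) := ⟨pow_ne_zero _ hp.ne_zero⟩
  have hπ := prime_pow_pred_mul_self_eq_zero p hm
  obtain ⟨c, g, hg, hτ⟩ := (mem_Q1Set_iff hm hn).1 hσ
  set τ := σ⁻¹ * Equiv.addRight (1 : ZMod (p ^ m)) * σ with hτ_def
  have hστ : ∀ x, σ (τ x) = σ x + 1 := fun x => by simp [hτ_def]
  have hc := isUnit_of_conj_addRight_one hp hm hστ hτ
  obtain ⟨v, hv⟩ := hc.exists_right_inv
  obtain ⟨h, hh, hhg⟩ := exists_comp_X_add_C_sub_eq hc (n + 1)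
    (fun k hk => by
      rw [ZMod.isUnit_iff_coprime]
      exact (Nat.coprime_of_lt_prime k.succ_ne_zero (by omega) hp).symm.pow_right _)
    (C (-v) * g)
    ((degree_lt_iff_coeff_zero _ _).2 fun j hj => coeff_eq_zero_of_natDegree_lt
      (((natDegree_C_mul_le _ _).trans hg).trans_lt hj))
  set π := (p : ZMod (p ^ m)) ^ (m - 1)
  have hshift : ∀ x, h.eval (x + c) - h.eval x = -v * g.eval x := fun x => by
    simpa using congrArg (eval x) hhg
  have hconst : ∀ x, σ x - (v * x + π * h.eval x) =
      0 - (v * σ.symm 0 + π * h.eval (σ.symm 0)) := fun x => by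
    have key := ZMod.eq_apply_zero_of_forall_add_one
      (f := fun y => y - (v * σ.symm y + π * h.eval (σ.symm y))) (fun y => by
        have hy : σ.symm (y + 1) = τ (σ.symm y) := by
          rw [Equiv.symm_apply_eq, hστ, Equiv.apply_symm_apply]
        simp only [hy, hτ, mul_eval_add_mul_of_mul_self_eq_zero hπ]
        linear_combination -hv - π * hshift (σ.symm y)) (σ x)
    simpa using key
  refine (mem_QSet_iff hm (by omega)).2 ⟨0 - (v * σ.symm 0 + π * h.eval (σ.symm 0)), v, h,
    .of_mul_eq_one c (by rw [mul_comm, hv]), hh, fun x => ?_⟩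
  linear_combination hconst x

/-- For an odd prime `p`, `m > 1`, and `1 ≤ n < p - 1`:
`H(Q₁^n) = {σ : σ⁻¹ T σ ∈ Q₁^n} = Q^(n+1)`. -/
theorem stmt_7 (p m n : ℕ) (hp : p.Prime) (hodd : Odd p) (hm : 1 < m)
    (hn1 : 1 ≤ n) (hnp : n < p - 1) :
    {σ : Equiv.Perm (ZMod (p ^ m)) |
      σ⁻¹ * Equiv.addRight (1 : ZMod (p ^ m)) * σ ∈ Q1Set p m n} = QSet p m (n + 1) := by
  ext σ
  exact ⟨mem_QSet_of_conj_mem_Q1Set hp hm hn1 hnp, conj_mem_Q1Set_of_mem_QSet hm hn1⟩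
end

section
/- Let n be a composite positive integer (n = a·b with a > 1 and b > 1), and let G be a subgroup of the group of permutations of ZMod n containing the translation T (a complete cycle of length n). If the natural action of G on ZMod n is primitive, then G is doubly transitive (the action of G on ZMod n is 2-transitive). -/
/-- A set `B` is a block for the subgroup `G` of permutations of `X`:
every `g ∈ G` maps `B` either onto itself or to a set disjoint from `B`. -/
def IsBlockFor {X : Type*} (G : Subgroup (Equiv.Perm X)) (B : Set X) : Prop :=
  ∀ g ∈ G, (g : Equiv.Perm X) '' B = B ∨ Disjoint ((g : Equiv.Perm X) '' B) B

section SchurMethod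

variable {H : Type*} [AddCommGroup H] {G : Subgroup (Equiv.Perm H)}

/-- A function `f` on `H` is difference-invariant if `(x, y) ↦ f (y - x)` is `G`-invariant. -/
def DiffInvariant {α : Type*} (G : Subgroup (Equiv.Perm H)) (f : H → α) : Prop :=
  ∀ g ∈ G, ∀ x y, f (g y - g x) = f (y - x)

theorem DiffInvariant.of_imp {P : H → Prop}
    (h : ∀ g ∈ G, ∀ x y, P (y - x) → P (g y - g x)) : DiffInvariant G P := by
  intro g hg x y
  refine propext ⟨fun hP => ?_, h g hg x y⟩
  simpa using h g⁻¹ (G.inv_mem hg) _ _ hP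

theorem DiffInvariant.comp {α β : Type*} {f : H → α} (hf : DiffInvariant G f) (φ : α → β) :
    DiffInvariant G (fun x => φ (f x)) :=
  fun g hg x y => congrArg φ (hf g hg x y)

theorem diffInvariant_ne_zero : DiffInvariant G (fun x : H => x ≠ 0) := by
  intro g _ x y
  simp [sub_eq_zero]

theorem DiffInvariant.and {P Q : H → Prop} (hP : DiffInvariant G P) (hQ : DiffInvariant G Q) :
    DiffInvariant G (fun x => P x ∧ Q x) :=
  fun g hg x y => congrArg₂ And (hP g hg x y) (hQ g hg x y)

theorem DiffInvariant.closure {S : Set H} (hS : DiffInvariant G (· ∈ S)) :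
    DiffInvariant G (· ∈ AddSubgroup.closure S) := by
  refine .of_imp fun g hg x y hxy => ?_
  suffices ∀ d ∈ AddSubgroup.closure S, ∀ x, g (x + d) - g x ∈ AddSubgroup.closure S by
    simpa using this _ hxy x
  intro d hd
  induction hd using AddSubgroup.closure_induction with
  | mem d hd =>
    intro x
    refine AddSubgroup.subset_closure ?_
    have := hS g hg x (x + d)
    simp_all
  | zero => simp
  | add a b _ _ iha ihb =>
    intro x
    have := add_mem (ihb (x + a)) (iha x)
    rwa [sub_add_sub_cancel, add_assoc] at this
  | neg a _ iha =>
    intro x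
    have := neg_mem (iha (x + -a))
    rwa [neg_sub, neg_add_cancel_right] at this

theorem DiffInvariant.isBlockFor {K : AddSubgroup H} (hK : DiffInvariant G (· ∈ K)) :
    IsBlockFor G (K : Set H) := by
  intro g hg
  rw [or_iff_not_imp_right, Set.not_disjoint_iff]
  rintro ⟨_, ⟨k, hk, rfl⟩, hgk⟩
  have key (z : H) : g z ∈ K ↔ z ∈ K := by
    have := hK g hg k z
    simp only [eq_iff_iff] at this
    rwa [sub_eq_add_neg, K.add_mem_cancel_right (neg_mem hgk), sub_eq_add_neg,
      K.add_mem_cancel_right (neg_mem hk)] at this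
  ext y
  constructor
  · rintro ⟨z, hz, rfl⟩
    exact (key z).2 hz
  · intro hy
    exact ⟨g⁻¹ y, (key _).1 (by simpa using hy), by simp⟩

/-- The subgroup of translations preserving `S`. -/
def translationStabilizer (S : Set H) : AddSubgroup H where
  carrier := {h | ∀ x, x + h ∈ S ↔ x ∈ S}
  zero_mem' := by simp
  add_mem' {a b} ha hb x := by rw [← add_assoc, hb, ha]
  neg_mem' {a} ha x := by rw [← ha, neg_add_cancel_right]

theorem DiffInvariant.translationStabilizer {S : Set H} (hS : DiffInvariant G (· ∈ S)) :
    DiffInvariant G (· ∈ translationStabilizer S) := by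
  have hmem (x y : H) : y - x ∈ _root_.translationStabilizer S ↔
      ∀ z, z - x ∈ S ↔ z - y ∈ S := by
    refine ⟨fun h z => ?_, fun h z => ?_⟩
    · have := h (z - y)
      rwa [sub_add_sub_cancel] at this
    · have := h (z + y)
      rwa [add_sub_cancel_right, add_sub_assoc] at this
  refine .of_imp fun g hg x y hxy => ?_
  rw [hmem] at hxy ⊢
  intro z
  have hx := hS g hg x (g⁻¹ z)
  have hy := hS g hg y (g⁻¹ z)
  have := hxy (g⁻¹ z)
  simp_all

/-- The number of representations of `h` as a difference of elements of `S`. -/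
def diffCount [DecidableEq H] (S : Finset H) (h : H) : ℕ := (S.filter (fun x => x - h ∈ S)).card

theorem diffCount_sub [DecidableEq H] [Fintype H] (S : Finset H) (x y : H) :
    diffCount S (y - x) = (Finset.univ.filter (fun z => z - x ∈ S ∧ z - y ∈ S)).card := by
  refine Finset.card_bij' (fun w _ => w + x) (fun z _ => z - x) ?_ ?_ ?_ ?_ <;>
    simp [← sub_add, sub_add_eq_add_sub]

theorem DiffInvariant.diffCount [DecidableEq H] [Fintype H] {S : Finset H}
    (hS : DiffInvariant G (· ∈ S)) : DiffInvariant G (diffCount S) := by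
  intro g hg x y
  rw [diffCount_sub, diffCount_sub]
  refine Finset.card_bij' (fun w _ => g⁻¹ w) (fun z _ => g z) ?_ ?_ (by simp) (by simp)
  · intro z
    have hx := hS g hg x (g⁻¹ z)
    have hy := hS g hg y (g⁻¹ z)
    simp_all
  · intro z
    have hx := hS g hg x z
    have hy := hS g hg y z
    simp_all

theorem sum_diffCount [DecidableEq H] [Fintype H] (S : Finset H) :
    ∑ h, diffCount S h = S.card * S.card := by
  simp only [diffCount, Finset.card_filter]
  rw [Finset.sum_comm, ← smul_eq_mul, ← Finset.sum_const]
  refine Finset.sum_congr rfl fun x _ => ?_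
  have := (Equiv.subLeft x).sum_comp (fun y => if y ∈ S then 1 else 0)
  simpa using this

theorem diffCount_zero [DecidableEq H] (S : Finset H) : diffCount S 0 = S.card := by
  simp [diffCount]

section MonoidAlgebra

variable {R : Type*} [CommRing R] [Fintype H]

theorem AddMonoidAlgebra.coeff_mul_sub (a b : AddMonoidAlgebra R H) (x y : H) :
    (a * b).coeff (y - x) = ∑ z, a.coeff (z - x) * b.coeff (y - z) := by
  classical
  rw [AddMonoidAlgebra.coeff_mul_antidiag a b (y - x)
    (Finset.univ.image fun z => (z - x, y - z))]
  · rw [Finset.sum_image]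
    intro z _ w _ h
    simpa using congrArg Prod.fst h
  · rintro ⟨u, v⟩
    simp only [Finset.mem_image, Finset.mem_univ, true_and, Prod.mk.injEq]
    constructor
    · rintro ⟨z, rfl, rfl⟩
      abel
    · intro h
      refine ⟨u + x, by simp, ?_⟩
      rw [add_comm u x, ← sub_sub, ← h, add_sub_cancel_left]

theorem DiffInvariant.coeff_mul {a b : AddMonoidAlgebra R H} (ha : DiffInvariant G a.coeff)
    (hb : DiffInvariant G b.coeff) : DiffInvariant G (a * b).coeff := by
  intro g hg x y
  rw [AddMonoidAlgebra.coeff_mul_sub, AddMonoidAlgebra.coeff_mul_sub, ← Equiv.sum_comp g]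
  exact Finset.sum_congr rfl fun z _ => by rw [ha g hg, hb g hg]

theorem DiffInvariant.coeff_pow {a : AddMonoidAlgebra R H} (ha : DiffInvariant G a.coeff)
    (k : ℕ) : DiffInvariant G (a ^ (k + 1)).coeff := by
  induction k with
  | zero => simpa using ha
  | succ k ih => simpa only [pow_succ _ (k + 1)] using ih.coeff_mul ha

theorem DiffInvariant.card_nsmul_fiber [DecidableEq H] {p : ℕ} [Fact p.Prime] {S : Finset H}
    (hS : DiffInvariant G (· ∈ S)) :
    DiffInvariant G (fun y => ((S.filter (fun s => p • s = y)).card : ZMod p)) := by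
  set a : AddMonoidAlgebra (ZMod p) H := ∑ s ∈ S, AddMonoidAlgebra.single s 1 with ha
  have hcoeff (y : H) : a.coeff y = if y ∈ S then 1 else 0 := by
    simp [ha, AddMonoidAlgebra.coeff_sum, Finsupp.single_apply]
  have : CharP (AddMonoidAlgebra (ZMod p) H) p :=
    charP_of_injective_algebraMap (algebraMap (ZMod p) _).injective p
  have hpow (y : H) :
      (a ^ p).coeff y = ((S.filter (fun s => p • s = y)).card : ZMod p) := by
    rw [ha, sum_pow_char]
    simp [AddMonoidAlgebra.single_pow, AddMonoidAlgebra.coeff_sum, Finsupp.single_apply]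
  have hinv : DiffInvariant G a.coeff := by
    intro g hg x y
    have := hS g hg x y
    simp_all
  have := hinv.coeff_pow (p - 1)
  rw [Nat.sub_add_cancel (Nat.Prime.one_le Fact.out)] at this
  intro g hg x y
  simpa only [hpow] using this g hg x y

end MonoidAlgebra

section Primitive

theorem DiffInvariant.eq_bot_or_eq_top
    (hprim : ∀ B : Set H, IsBlockFor G B → B.Subsingleton ∨ B = Set.univ)
    {K : AddSubgroup H} (hK : DiffInvariant G (· ∈ K)) : K = ⊥ ∨ K = ⊤ := by
  refine (hprim K hK.isBlockFor).imp (fun h => ?_) (fun h => ?_)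
  · exact (AddSubgroup.eq_bot_iff_forall K).2 fun x hx => h hx K.zero_mem
  · exact SetLike.coe_injective h

theorem DiffInvariant.subset_zero_of_subset
    (hprim : ∀ B : Set H, IsBlockFor G B → B.Subsingleton ∨ B = Set.univ)
    {S : Set H} (hS : DiffInvariant G (· ∈ S)) {K : AddSubgroup H} (hK : K ≠ ⊤)
    (hSK : S ⊆ K) {x : H} (hx : x ∈ S) : x = 0 := by
  rcases hS.closure.eq_bot_or_eq_top hprim with h | h
  · simpa [h] using AddSubgroup.subset_closure (k := S) hx
  · exact absurd (top_le_iff.1 (h ▸ (AddSubgroup.closure_le K).2 hSK)) hK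

variable [Fintype H] {p : ℕ}

theorem card_nsmul_eq_zero_filter_le [IsAddCyclic H] [DecidableEq H] (hp : 0 < p) (t : H) :
    (Finset.univ.filter (fun x : H => p • x = p • t)).card ≤ p := by
  refine le_trans (Finset.card_le_card_of_injOn (fun x => x - t) ?_ ?_)
    (IsAddCyclic.card_nsmul_eq_zero_le (α := H) hp)
  · intro x hx
    simpa [nsmul_sub, sub_eq_zero] using hx
  · exact (sub_left_injective).injOn

theorem exists_ne_zero_nsmul_eq_zero (hp : p.Prime) (hdvd : p ∣ Fintype.card H) :
    ∃ x : H, x ≠ 0 ∧ p • x = 0 := by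
  have := Fact.mk hp
  obtain ⟨x, hx⟩ := exists_prime_addOrderOf_dvd_card p hdvd
  refine ⟨x, ?_, hx ▸ addOrderOf_nsmul_eq_zero x⟩
  rintro rfl
  exact hp.one_lt.ne (by simpa using hx)

theorem DiffInvariant.dvd_card_nsmul_fiber [DecidableEq H]
    (hprim : ∀ B : Set H, IsBlockFor G B → B.Subsingleton ∨ B = Set.univ)
    (hp : p.Prime) (hdvd : p ∣ Fintype.card H) {S : Finset H} (hS : DiffInvariant G (· ∈ S))
    {y : H} (hy : y ≠ 0) : p ∣ (S.filter (fun s => p • s = y)).card := by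
  have := Fact.mk hp
  rw [← CharP.cast_eq_zero_iff (ZMod p)]
  by_contra hne
  refine hy (((hS.card_nsmul_fiber (p := p)).comp (· ≠ 0)).subset_zero_of_subset
    (S := {y | ((S.filter (fun s => p • s = y)).card : ZMod p) ≠ 0})
    hprim (K := (nsmulAddMonoidHom p : H →+ H).range) ?_ ?_ hne)
  · rw [Ne, AddMonoidHom.range_eq_top, ← Finite.injective_iff_surjective]
    intro hinj
    obtain ⟨x, hx0, hx⟩ := exists_ne_zero_nsmul_eq_zero hp hdvd
    exact hx0 (hinj (by simpa using hx))
  · intro z hz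
    have : (S.filter (fun s => p • s = z)).Nonempty := by
      rw [Finset.nonempty_iff_ne_empty]
      intro h
      simp [h] at hz
    obtain ⟨s, hs⟩ := this
    exact ⟨s, by simpa using (Finset.mem_filter.1 hs).2⟩

theorem DiffInvariant.mem_of_nsmul_eq [IsAddCyclic H] [DecidableEq H]
    (hprim : ∀ B : Set H, IsBlockFor G B → B.Subsingleton ∨ B = Set.univ)
    (hp : p.Prime) (hdvd : p ∣ Fintype.card H) {S : Finset H} (hS : DiffInvariant G (· ∈ S))
    {t u : H} (ht : t ∈ S) (ht0 : p • t ≠ 0) (hu : p • u = p • t) : u ∈ S := by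
  have hle : p ≤ (S.filter (fun s => p • s = p • t)).card :=
    Nat.le_of_dvd (Finset.card_pos.2 ⟨t, by simp [ht]⟩)
      (hS.dvd_card_nsmul_fiber hprim hp hdvd ht0)
  have heq : S.filter (fun s => p • s = p • t) =
      Finset.univ.filter (fun s => p • s = p • t) :=
    Finset.eq_of_subset_of_card_le (Finset.filter_subset_filter _ (Finset.subset_univ S))
      ((card_nsmul_eq_zero_filter_le hp.pos t).trans hle)
  have : u ∈ S.filter (fun s => p • s = p • t) := by simp [heq, hu]
  exact (Finset.mem_filter.1 this).1

theorem DiffInvariant.exists_nsmul_eq_zero [IsAddCyclic H] [DecidableEq H]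
    (hprim : ∀ B : Set H, IsBlockFor G B → B.Subsingleton ∨ B = Set.univ)
    (hp : p.Prime) (hdvd : p ∣ Fintype.card H) {S : Finset H} (hS : DiffInvariant G (· ∈ S))
    (hne : S.Nonempty) (h0 : 0 ∉ S) : ∃ s ∈ S, p • s = 0 := by
  by_contra! hno
  obtain ⟨x, hx0, hx⟩ := exists_ne_zero_nsmul_eq_zero hp hdvd
  have hxK : x ∈ _root_.translationStabilizer (S : Set H) := by
    intro z
    have hz : p • (z + x) = p • z := by rw [nsmul_add, hx, add_zero]
    exact ⟨fun h => hS.mem_of_nsmul_eq hprim hp hdvd h (hno _ h) hz.symm,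
      fun h => hS.mem_of_nsmul_eq hprim hp hdvd h (hno _ h) hz⟩
  obtain ⟨s, hs⟩ := hne
  rcases (DiffInvariant.translationStabilizer (S := (S : Set H)) hS).eq_bot_or_eq_top hprim
    with h | h
  · rw [h] at hxK
    exact hx0 hxK
  · have : s ∈ _root_.translationStabilizer (S : Set H) := h ▸ AddSubgroup.mem_top s
    exact h0 ((this 0).1 (by simpa using hs))

theorem DiffInvariant.card_filter_le_diffCount [IsAddCyclic H] [DecidableEq H]
    (hprim : ∀ B : Set H, IsBlockFor G B → B.Subsingleton ∨ B = Set.univ)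
    (hp : p.Prime) (hdvd : p ∣ Fintype.card H) {S : Finset H} (hS : DiffInvariant G (· ∈ S))
    {h : H} (hh : h ≠ 0) : (S.filter (fun s => p • s ≠ 0)).card ≤ _root_.diffCount S h := by
  have hlevel : DiffInvariant G (· ∈ Finset.univ.filter
      (fun k => k ≠ 0 ∧ _root_.diffCount S k = _root_.diffCount S h)) := by
    simpa using diffInvariant_ne_zero.and (hS.diffCount.comp (· = _root_.diffCount S h))
  obtain ⟨k, hk, hpk⟩ := hlevel.exists_nsmul_eq_zero hprim hp hdvd ⟨h, by simp [hh]⟩ (by simp)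
  rw [← (Finset.mem_filter.1 hk).2.2]
  refine Finset.card_le_card fun s hs => ?_
  obtain ⟨hsS, hs0⟩ := Finset.mem_filter.1 hs
  exact Finset.mem_filter.2 ⟨hsS, hS.mem_of_nsmul_eq hprim hp hdvd hsS hs0
    (by rw [nsmul_sub, hpk, sub_zero])⟩

theorem DiffInvariant.card_le_two_mul_card [IsAddCyclic H] [DecidableEq H]
    (hprim : ∀ B : Set H, IsBlockFor G B → B.Subsingleton ∨ B = Set.univ)
    (hp : p.Prime) (hdvd : p ∣ Fintype.card H) (hlt : p < Fintype.card H)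
    {S : Finset H} (hS : DiffInvariant G (· ∈ S)) (hne : S.Nonempty) (h0 : 0 ∉ S) :
    Fintype.card H ≤ 2 * S.card := by
  set A := S.filter (fun s => p • s = 0) with hA
  set B := S.filter (fun s => p • s ≠ 0) with hB
  have hAB : A.card + B.card = S.card := Finset.card_filter_add_card_filter_not _
  have hker : (Finset.univ.filter (fun x : H => p • x = 0)).card ≤ p :=
    IsAddCyclic.card_nsmul_eq_zero_le hp.pos
  have hAp : A.card < p := by
    refine lt_of_lt_of_le (Finset.card_lt_card ?_) hker
    rw [Finset.ssubset_iff_of_subset (Finset.filter_subset_filter _ (Finset.subset_univ S))]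
    exact ⟨0, by simp, by simp [h0]⟩
  have hBp : p ≤ B.card := by
    have hBne : B.Nonempty := by
      by_contra hBe
      rw [Finset.not_nonempty_iff_eq_empty, hB, Finset.filter_eq_empty_iff] at hBe
      obtain ⟨s, hs⟩ := hne
      refine h0 ((hS.subset_zero_of_subset hprim (S := (S : Set H))
        (K := (nsmulAddMonoidHom p : H →+ H).ker) ?_ ?_ hs) ▸ hs)
      · intro htop
        have hall (x : H) : p • x = 0 := by
          have : x ∈ (nsmulAddMonoidHom p : H →+ H).ker := htop ▸ AddSubgroup.mem_top x
          simpa using this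
        simp only [hall, Finset.filter_true, Finset.card_univ] at hker
        omega
      · intro x hx
        simpa using hBe hx
    obtain ⟨t, ht⟩ := hBne
    obtain ⟨-, ht0⟩ := Finset.mem_filter.1 ht
    refine (Nat.le_of_dvd (Finset.card_pos.2 ⟨t, ?_⟩)
      (hS.dvd_card_nsmul_fiber hprim hp hdvd ht0)).trans (Finset.card_le_card fun x hx => ?_)
    · simp [(Finset.mem_filter.1 ht).1]
    · obtain ⟨hxS, hx⟩ := Finset.mem_filter.1 hx
      exact Finset.mem_filter.2 ⟨hxS, hx ▸ ht0⟩
  have hsum : (Fintype.card H - 1) * B.card + S.card ≤ S.card * S.card := by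
    rw [← sum_diffCount, ← Finset.sum_erase_add _ _ (Finset.mem_univ (0 : H)), diffCount_zero]
    refine Nat.add_le_add_right ?_ _
    rw [← Finset.card_univ, ← Finset.card_erase_of_mem (Finset.mem_univ (0 : H)), ← smul_eq_mul]
    exact Finset.card_nsmul_le_sum _ _ _ fun h hh =>
      hS.card_filter_le_diffCount hprim hp hdvd (Finset.ne_of_mem_erase hh)
  by_contra! hcon
  have h1 : 2 * S.card * B.card ≤ (Fintype.card H - 1) * B.card :=
    Nat.mul_le_mul_right _ (by omega)
  have h2 : S.card * (2 * B.card + 1) ≤ S.card * S.card := by linarith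
  have h3 := Nat.le_of_mul_le_mul_left h2 hne.card_pos
  omega

/-- **Burnside–Schur**, for permutation groups of a finite cyclic group `H` of composite order
that contain all translations. -/
theorem exists_perm_of_primitive [IsAddCyclic H] (hT : ∀ h : H, Equiv.addRight h ∈ G)
    (hprim : ∀ B : Set H, IsBlockFor G B → B.Subsingleton ∨ B = Set.univ)
    (hp : p.Prime) (hdvd : p ∣ Fintype.card H) (hlt : p < Fintype.card H)
    {x₁ x₂ y₁ y₂ : H} (hx : x₁ ≠ x₂) (hy : y₁ ≠ y₂) :
    ∃ g ∈ G, g x₁ = y₁ ∧ g x₂ = y₂ := by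
  classical
  set S : Finset H :=
    Finset.univ.filter fun h => ∃ g ∈ G, g x₂ - g x₁ = h with hSdef
  have hS : DiffInvariant G (· ∈ S) := by
    refine .of_imp fun g hg x y hxy => ?_
    simp only [hSdef, Finset.mem_filter, Finset.mem_univ, true_and] at hxy ⊢
    obtain ⟨k, hk, hkxy⟩ := hxy
    refine ⟨g * Equiv.addRight (x - k x₁) * k, mul_mem (mul_mem hg (hT _)) hk, ?_⟩
    have h2 : k x₂ + (x - k x₁) = y := by
      rw [← add_sub_assoc, add_sub_right_comm, hkxy, sub_add_cancel]
    simp [h2]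
  have h0 : 0 ∉ S := by simp [hSdef, sub_eq_zero, hx.symm]
  have hSne : S.Nonempty := ⟨x₂ - x₁, by simpa [hSdef] using ⟨1, G.one_mem, by simp⟩⟩
  have hyS : y₂ - y₁ ∈ S := by
    by_contra hyS
    have hS' : DiffInvariant G (· ∈ Finset.univ.filter fun h => h ≠ 0 ∧ h ∉ S) := by
      simpa using diffInvariant_ne_zero.and (hS.comp Not)
    have hc := hS.card_le_two_mul_card hprim hp hdvd hlt hSne h0
    have hc' := hS'.card_le_two_mul_card hprim hp hdvd hlt
      ⟨y₂ - y₁, by simp [hyS, sub_eq_zero, hy.symm]⟩ (by simp)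
    have hdisj : Disjoint S (Finset.univ.filter fun h => h ≠ 0 ∧ h ∉ S) :=
      Finset.disjoint_left.2 fun h hh hh' => (Finset.mem_filter.1 hh').2.2 hh
    have hss : S ∪ (Finset.univ.filter fun h => h ≠ 0 ∧ h ∉ S) ⊂ Finset.univ := by
      rw [Finset.ssubset_univ_iff]
      intro h
      have := h ▸ Finset.mem_univ (0 : H)
      simp [h0] at this
    have := Finset.card_lt_card hss
    rw [Finset.card_union_of_disjoint hdisj, Finset.card_univ] at this
    omega
  obtain ⟨k, hk, hky⟩ := (Finset.mem_filter.1 hyS).2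
  refine ⟨Equiv.addRight (y₁ - k x₁) * k, mul_mem (hT _) hk, by simp, ?_⟩
  have : k x₂ + (y₁ - k x₁) = y₂ := by
    rw [← add_sub_assoc, add_sub_right_comm, hky, sub_add_cancel]
  simpa using this

end Primitive

end SchurMethod

/-- Burnside–Schur: a subgroup of permutations of `ZMod n` (`n` composite) containing
the complete cycle `T` whose action is primitive is doubly transitive. -/
theorem stmt_15 (n a b : ℕ) (ha : 1 < a) (hb : 1 < b) (hn : n = a * b)
    (G : Subgroup (Equiv.Perm (ZMod n)))
    (hT : Equiv.addRight (1 : ZMod n) ∈ G)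
    (hprim : ∀ B : Set (ZMod n), IsBlockFor G B → B.Subsingleton ∨ B = Set.univ) :
    ∀ x₁ x₂ y₁ y₂ : ZMod n, x₁ ≠ x₂ → y₁ ≠ y₂ →
      ∃ g ∈ G, (g : Equiv.Perm (ZMod n)) x₁ = y₁ ∧ (g : Equiv.Perm (ZMod n)) x₂ = y₂ := by
  have hn0 : n ≠ 0 := by subst hn; positivity
  have := NeZero.mk hn0
  have ha1 : a ≠ 1 := ha.ne'
  have hlt : a.minFac < n := by
    rw [hn]
    exact (Nat.minFac_le (by omega)).trans_lt (lt_mul_of_one_lt_right (by omega) hb)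
  have hpow (k : ℕ) : Equiv.addRight (k : ZMod n) ∈ G := by
    induction k with
    | zero => simp
    | succ k ih =>
      rw [Nat.cast_succ]
      convert! mul_mem hT ih using 1
      ext x
      simp [add_assoc]
  have hT' (h : ZMod n) : Equiv.addRight h ∈ G := by
    simpa using hpow h.val
  intro x₁ x₂ y₁ y₂ hx hy
  refine exists_perm_of_primitive hT' hprim (Nat.minFac_prime ha1) ?_ ?_ hx hy
  · rw [ZMod.card, hn]
    exact (Nat.minFac_dvd a).mul_right b
  · rwa [ZMod.card]
end

section
/- Let p be a prime, m > 1, and let G be a subgroup of the group of permutations of ZMod p^m containing the translation T. Suppose the action of G on ZMod p^m is not primitive (G is imprimitive). Let N be the normal closure in G of the cyclic subgroup generated by T^{p^{m−1}} (the subgroup generated by all conjugates g T^{p^{m−1}} g⁻¹ for g ∈ G). Then N is not transitive on ZMod p^m, and every orbit of N on ZMod p^m is a block for the action of G; i.e., the orbits of N form a complete block system of G. -/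
open scoped Pointwise

theorem Equiv.addRight_pow {A : Type*} [AddGroup A] (a : A) (n : ℕ) :
    (Equiv.addRight a : Equiv.Perm A) ^ n = Equiv.addRight (n • a) := by
  induction n with
  | zero => ext; simp
  | succ n ih =>
    ext x
    simp [pow_succ', ih, succ_nsmul, add_assoc]

theorem ZMod.exists_nsmul_eq_prime_pow {p m : ℕ} (hp : p.Prime) {d : ZMod (p ^ m)}
    (hd : d ≠ 0) : ∃ k : ℕ, k • d = ((p ^ (m - 1) : ℕ) : ZMod (p ^ m)) := by
  have : NeZero (p ^ m) := ⟨pow_ne_zero m hp.ne_zero⟩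
  obtain ⟨j, hjm, hj⟩ := (Nat.dvd_prime_pow hp).1 (Nat.gcd_dvd_right d.val (p ^ m))
  have hlt : j ≠ m := by
    rintro rfl
    have hdvd : p ^ j ∣ d.val := by
      simpa only [hj] using Nat.gcd_dvd_left d.val (p ^ j)
    exact hd ((ZMod.val_eq_zero d).1 (Nat.eq_zero_of_dvd_of_lt hdvd d.val_lt))
  have hgcd : ((p ^ j : ℕ) : ZMod (p ^ m)) = d * (d.val.gcdA (p ^ m) : ZMod (p ^ m)) := by
    have h := congrArg (Int.cast : ℤ → ZMod (p ^ m)) (Nat.gcd_eq_gcd_ab d.val (p ^ m))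
    rw [hj, Int.cast_natCast, Int.cast_add, Int.cast_mul, Int.cast_mul, Int.cast_natCast,
      Int.cast_natCast, ZMod.natCast_self, zero_mul, add_zero, ZMod.natCast_zmod_val] at h
    exact h
  refine ⟨((d.val.gcdA (p ^ m) : ZMod (p ^ m)) * ((p ^ (m - 1 - j) : ℕ) : ZMod (p ^ m))).val, ?_⟩
  rw [nsmul_eq_mul, ZMod.natCast_zmod_val,
    show p ^ (m - 1) = p ^ j * p ^ (m - 1 - j) by rw [← pow_add]; congr 1; lia,
    Nat.cast_mul, hgcd]
  ring

theorem IsBlockFor.image {X : Type*} {G : Subgroup (Equiv.Perm X)} {B : Set X}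
    (hB : IsBlockFor G B) {g : Equiv.Perm X} (hg : g ∈ G) : IsBlockFor G (g '' B) := by
  intro h hh
  have key : h '' (g '' B) = g '' ((g⁻¹ * h * g : Equiv.Perm X) '' B) := by
    simp only [← Set.image_comp, ← Equiv.Perm.coe_mul]
    congr 2
    group
  rw [key]
  rcases hB _ (G.mul_mem (G.mul_mem (G.inv_mem hg) hh) hg) with h' | h'
  · exact Or.inl (by rw [h'])
  · exact Or.inr ((Set.disjoint_image_iff g.injective).2 h')

/-- A block with two distinct points is invariant under translation by `p ^ (m - 1)`. -/
theorem IsBlockFor.addRight_one_pow_smul_eq {p m : ℕ} (hp : p.Prime)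
    {G : Subgroup (Equiv.Perm (ZMod (p ^ m)))}
    (hT : Equiv.addRight (1 : ZMod (p ^ m)) ∈ G) {B : Set (ZMod (p ^ m))}
    (hB : IsBlockFor G B) (hnt : B.Nontrivial) :
    (Equiv.addRight (1 : ZMod (p ^ m))) ^ p ^ (m - 1) • B = B := by
  have : NeZero (p ^ m) := ⟨pow_ne_zero m hp.ne_zero⟩
  obtain ⟨a, ha, b, hb, hab⟩ := hnt
  have hd : Equiv.addRight (b - a) ∈ MulAction.stabilizer (Equiv.Perm (ZMod (p ^ m))) B := by
    have hmem : Equiv.addRight (b - a) ∈ G := by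
      have := G.pow_mem hT (b - a).val
      rwa [Equiv.addRight_pow, nsmul_one, ZMod.natCast_zmod_val] at this
    refine MulAction.mem_stabilizer_iff.2 ((hB _ hmem).resolve_right fun hdisj => ?_)
    exact Set.disjoint_left.1 hdisj ⟨a, ha, by simp⟩ hb
  obtain ⟨k, hk⟩ := ZMod.exists_nsmul_eq_prime_pow hp (sub_ne_zero.2 hab.symm)
  have := Subgroup.pow_mem _ hd k
  rw [Equiv.addRight_pow, hk] at this
  rw [Equiv.addRight_pow, nsmul_one]
  exact this

theorem Subgroup.conj_mem_closure_conjugates {H : Type*} [Group H] {G : Subgroup H} {t g n : H}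
    (hg : g ∈ G) (hn : n ∈ closure {x | ∃ g ∈ G, x = g * t * g⁻¹}) :
    g * n * g⁻¹ ∈ closure {x | ∃ g ∈ G, x = g * t * g⁻¹} := by
  induction hn using closure_induction with
  | mem x hx =>
    obtain ⟨k, hk, rfl⟩ := hx
    exact subset_closure ⟨g * k, G.mul_mem hg hk, by group⟩
  | one => simp [one_mem]
  | mul x y _ _ hx hy => simpa [mul_assoc] using mul_mem hx hy
  | inv x _ hx => simpa [mul_assoc] using inv_mem hx

/-- Orbits of a subgroup normalized by `G` are blocks for `G`. -/
theorem isBlockFor_orbit {X : Type*} {G N : Subgroup (Equiv.Perm X)}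
    (hconj : ∀ g ∈ G, ∀ n ∈ N, g * n * g⁻¹ ∈ N) (x : X) :
    IsBlockFor G {y | ∃ h ∈ N, (h : Equiv.Perm X) x = y} := by
  intro g hg
  have himage : g '' {y | ∃ h ∈ N, (h : Equiv.Perm X) x = y} = MulAction.orbit N (g x) := by
    ext z
    constructor
    · rintro ⟨_, ⟨n, hn, rfl⟩, rfl⟩
      exact ⟨⟨g * n * g⁻¹, hconj g hg n hn⟩, by simp [Subgroup.smul_def]⟩
    · rintro ⟨⟨n, hn⟩, rfl⟩
      have h := hconj g⁻¹ (G.inv_mem hg) n hn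
      exact ⟨_, ⟨_, h, rfl⟩, by simp [Subgroup.smul_def]⟩
  have horbit : {y | ∃ h ∈ N, (h : Equiv.Perm X) x = y} = MulAction.orbit N x := by
    ext z
    simp [MulAction.mem_orbit_iff, Subgroup.smul_def]
  rw [himage, horbit]
  exact MulAction.orbit.eq_or_disjoint _ _

/-- Let `G ≤ S_{p^m}` contain `T`, with `G` imprimitive, and let `N` be the normal
closure in `G` of `⟨T^(p^(m-1))⟩` (generated by the conjugates `g T^(p^(m-1)) g⁻¹`,
`g ∈ G`). Then `N` is not transitive, and the orbits of `N` form a complete block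
system for `G`. -/
theorem stmt_16 (p m : ℕ) (hp : p.Prime) (hm : 1 < m)
    (G : Subgroup (Equiv.Perm (ZMod (p ^ m))))
    (hT : Equiv.addRight (1 : ZMod (p ^ m)) ∈ G)
    (himprim : ∃ B : Set (ZMod (p ^ m)),
      IsBlockFor G B ∧ ¬ B.Subsingleton ∧ B ≠ Set.univ)
    (N : Subgroup (Equiv.Perm (ZMod (p ^ m))))
    (hN : N = Subgroup.closure
      {x | ∃ g ∈ G, x = g * (Equiv.addRight (1 : ZMod (p ^ m))) ^ p ^ (m - 1) * g⁻¹}) :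
    (¬ ∀ x y : ZMod (p ^ m), ∃ h ∈ N, (h : Equiv.Perm (ZMod (p ^ m))) x = y) ∧
    (∀ x : ZMod (p ^ m),
      IsBlockFor G {y | ∃ h ∈ N, (h : Equiv.Perm (ZMod (p ^ m))) x = y}) := by
  subst hN
  refine ⟨fun htrans => ?_, isBlockFor_orbit fun g hg n hn =>
    Subgroup.conj_mem_closure_conjugates hg hn⟩
  obtain ⟨B, hB, hnt, hne⟩ := himprim
  rw [Set.not_subsingleton_iff] at hnt
  have hstab : Subgroup.closure
      {x | ∃ g ∈ G, x = g * (Equiv.addRight (1 : ZMod (p ^ m))) ^ p ^ (m - 1) * g⁻¹} ≤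
      MulAction.stabilizer (Equiv.Perm (ZMod (p ^ m))) B := by
    rw [Subgroup.closure_le]
    rintro _ ⟨g, hg, rfl⟩
    have hfix : _ • (g⁻¹ • B) = g⁻¹ • B := (hB.image (G.inv_mem hg)).addRight_one_pow_smul_eq hp hT
      (hnt.image (g⁻¹).injective)
    rw [SetLike.mem_coe, MulAction.mem_stabilizer_iff, mul_smul, mul_smul, hfix, smul_inv_smul]
  obtain ⟨b, hb⟩ := hnt.nonempty
  refine hne (Set.eq_univ_of_forall fun y => ?_)
  obtain ⟨n, hn, rfl⟩ := htrans b y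
  have hnB : n • B = B := hstab hn
  exact hnB ▸ Set.smul_mem_smul_set hb
end

section
/- Let p be a prime and let G be a subgroup of the group of permutations of ZMod p containing the translation T. If the action of G on ZMod p is not doubly transitive, then G is contained in the affine group AG(p), the order of G equals p·m for some divisor m of p − 1, the cyclic subgroup ⟨T⟩ is a normal Sylow p-subgroup of G, and G is solvable. -/
/-- The affine group `AG(p)`: all permutations `x ↦ a x + b` of `ZMod p` with `a ≠ 0`. -/
def AGSetP (p : ℕ) : Set (Equiv.Perm (ZMod p)) :=
  {f | ∃ a b : ZMod p, a ≠ 0 ∧ ∀ x, f x = a * x + b}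

open Polynomial in
/-- If the power sums of `U` vanish in degrees strictly between `0` and `m`, then summing a polynomial
of degree at most `m` over `U` only sees its coefficients in degrees `0` and `m`. -/
lemma sum_eval_eq_of_power_sums_eq_zero {R : Type*} [CommRing R] (U : Finset R) {m : ℕ}
    (hm : 0 < m) (hU : ∀ j, 0 < j → j < m → ∑ u ∈ U, u ^ j = 0) (q : R[X])
    (hq : q.natDegree ≤ m) :
    ∑ u ∈ U, q.eval u = (U.card : R) * q.coeff 0 + (∑ u ∈ U, u ^ m) * q.coeff m := by
  obtain ⟨k, rfl⟩ := Nat.exists_eq_add_of_lt hm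
  simp only [eval_eq_sum_range' (Nat.lt_succ_of_le hq)]
  rw [Finset.sum_comm]
  simp only [← Finset.mul_sum]
  rw [Finset.sum_range_succ, Finset.sum_eq_single_of_mem 0 (by simp)]
  · simp [mul_comm]
  · intro j hj hj0
    rw [hU j (Nat.pos_of_ne_zero hj0) (Finset.mem_range.1 hj), mul_zero]

open Polynomial in
/-- Every function on `ZMod p` is given by a polynomial of degree less than `p`. -/
lemma exists_polynomial_eval_eq {p : ℕ} [Fact p.Prime] (F : ZMod p → ZMod p) :
    ∃ q : (ZMod p)[X], q.natDegree < p ∧ ∀ x, q.eval x = F x := by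
  have hinj : Set.InjOn (id : ZMod p → ZMod p) (Finset.univ : Finset (ZMod p)) :=
    Function.injective_id.injOn
  refine ⟨Lagrange.interpolate Finset.univ id F, ?_, fun x => ?_⟩
  · have h := Lagrange.degree_interpolate_lt F hinj
    rw [Finset.card_univ, ZMod.card] at h
    by_cases h0 : Lagrange.interpolate Finset.univ id F = 0
    · rw [h0]; simpa using (Fact.out : p.Prime).pos
    · exact (natDegree_lt_iff_degree_lt h0).2 h
  · exact Lagrange.eval_interpolate_at_node F hinj (Finset.mem_univ x)

open Polynomial in
/-- Polynomials of degree less than `p` are determined by their values on `ZMod p`. -/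
lemma polynomial_eq_of_eval_eq {p : ℕ} [Fact p.Prime] {q r : (ZMod p)[X]}
    (hq : q.natDegree < p) (hr : r.natDegree < p) (h : ∀ x, q.eval x = r.eval x) : q = r := by
  have key : ∀ f : (ZMod p)[X], f.natDegree < p →
      f.degree < (Finset.univ : Finset (ZMod p)).card := fun f hf => by
    rw [Finset.card_univ, ZMod.card]
    exact lt_of_le_of_lt degree_le_natDegree (by exact_mod_cast hf)
  exact eq_of_degrees_lt_of_eval_finset_eq Finset.univ (key q hq) (key r hr) fun x _ => h x

open Polynomial in
lemma sum_univ_eval_eq_neg_coeff {p : ℕ} [Fact p.Prime] (q : (ZMod p)[X])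
    (hq : q.natDegree ≤ p - 1) : ∑ x, q.eval x = -q.coeff (p - 1) := by
  have hp : p.Prime := Fact.out
  have hp1 : 0 < p - 1 := Nat.sub_pos_of_lt hp.one_lt
  rw [sum_eval_eq_of_power_sums_eq_zero Finset.univ hp1 _ q hq]
  · have hpow : ∀ x : ZMod p, x ^ (p - 1) = 1 - if x = 0 then 1 else 0 := fun x => by
      split_ifs with hx
      · simp [hx, hp1.ne']
      · rw [ZMod.pow_card_sub_one_eq_one hx, sub_zero]
    simp [hpow]
  · intro j _ hj
    exact FiniteField.sum_pow_lt_card_sub_one (ZMod p) j (by rwa [ZMod.card])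

open Polynomial in
/-- If `m` is the least positive degree in which the power sum of `U` does not vanish, a polynomial
of degree at least `m` whose `U`-averaging changes it by a constant has degree exactly `m`. -/
lemma natDegree_eq_of_sum_eval_add_eq {p : ℕ} [Fact p.Prime] (U : Finset (ZMod p)) {m : ℕ}
    (hm : 0 < m) (hU : ∀ j, 0 < j → j < m → ∑ u ∈ U, u ^ j = 0) (hUm : ∑ u ∈ U, u ^ m ≠ 0)
    (g : (ZMod p)[X]) (hg : g.natDegree < p) (c : ZMod p)
    (h : ∀ x, ∑ u ∈ U, g.eval (x + u) = (U.card : ZMod p) * g.eval x + c)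
    (hgm : m ≤ g.natDegree) : g.natDegree = m ∧ c ≠ 0 := by
  have hp : p.Prime := Fact.out
  have hg0 : g ≠ 0 := by
    rintro rfl
    simp at hgm
    omega
  have hpoly : ∑ u ∈ U, taylor u g = C (U.card : ZMod p) * g + C c := by
    apply polynomial_eq_of_eval_eq
    · refine lt_of_le_of_lt (natDegree_sum_le_of_forall_le (n := g.natDegree) U _ fun u _ => ?_) hg
      rw [natDegree_taylor]
    · refine lt_of_le_of_lt ?_ hg
      rw [natDegree_add_C]
      exact natDegree_C_mul_le _ _
    · intro x
      simp only [eval_finsetSum, taylor_eval, eval_add, eval_mul, eval_C]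
      rw [← h x]
  have hcoeff := congrArg (fun q => q.coeff (g.natDegree - m)) hpoly
  simp only [finsetSum_coeff, taylor_coeff, coeff_add, coeff_C_mul, coeff_C] at hcoeff
  rw [sum_eval_eq_of_power_sums_eq_zero U hm hU _
    ((natDegree_hasseDeriv_le _ _).trans (by omega))] at hcoeff
  simp only [hasseDeriv_coeff, zero_add, Nat.choose_self, Nat.cast_one, one_mul,
    Nat.add_sub_cancel' hgm] at hcoeff
  have hchoose : ((g.natDegree.choose (g.natDegree - m) : ℕ) : ZMod p) ≠ 0 := by
    rw [Ne, ZMod.natCast_eq_zero_iff]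
    intro hdvd
    have hfac := Nat.choose_mul_factorial_mul_factorial (Nat.sub_le g.natDegree m)
    have : p ∣ g.natDegree.factorial := by
      rw [← hfac, mul_assoc]
      exact hdvd.mul_right _
    exact absurd ((hp.dvd_factorial).1 this) (by omega)
  have hne := mul_ne_zero hUm (mul_ne_zero hchoose (leadingCoeff_ne_zero.2 hg0))
  rw [add_right_inj] at hcoeff
  rw [leadingCoeff, hcoeff] at hne
  split_ifs at hne with h0
  · exact ⟨by omega, hne⟩
  · exact absurd rfl hne

open Polynomial in
/-- A nonempty set of nonzero residues missing some nonzero residue has a nonvanishing power sum in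
some positive degree less than `p - 1`. -/
lemma exists_power_sum_ne_zero {p : ℕ} [Fact p.Prime] (U : Finset (ZMod p)) (hne : U.Nonempty)
    (h0 : 0 ∉ U) {b : ZMod p} (hb : b ≠ 0) (hbU : b ∉ U) :
    ∃ m, 0 < m ∧ m < p - 1 ∧ ∑ u ∈ U, u ^ m ≠ 0 := by
  have hp : p.Prime := Fact.out
  have hp1 : 0 < p - 1 := Nat.sub_pos_of_lt hp.one_lt
  by_contra! hU
  have hsum := sum_eval_eq_of_power_sums_eq_zero U hp1 hU ((X - C b) ^ (p - 1)) (by simp)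
  have hcard : (U.card : ZMod p) ≠ 0 := by
    rw [Ne, ZMod.natCast_eq_zero_iff]
    intro hdvd
    have hlt : U.card < p := by
      have := Finset.card_lt_univ_of_notMem h0
      rwa [ZMod.card] at this
    exact absurd (Nat.le_of_dvd hne.card_pos hdvd) (by omega)
  have hlead : ((X - C b) ^ (p - 1)).coeff (p - 1) = 1 := by
    have := ((monic_X_sub_C b).pow (p - 1)).coeff_natDegree
    simpa using this
  have h1 : ∀ u ∈ U, ((X - C b) ^ (p - 1)).eval u = 1 := fun u hu => by
    rw [eval_pow]
    apply ZMod.pow_card_sub_one_eq_one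
    simpa [sub_eq_zero] using fun h : u = b => hbU (h ▸ hu)
  have h2 : ∀ u ∈ U, u ^ (p - 1) = 1 := fun u hu =>
    ZMod.pow_card_sub_one_eq_one fun h => h0 (h ▸ hu)
  have h3 : ((X - C b) ^ (p - 1)).coeff 0 = 1 := by
    rw [coeff_zero_eq_eval_zero, eval_pow]
    apply ZMod.pow_card_sub_one_eq_one
    simpa using hb
  rw [Finset.sum_congr rfl h1, Finset.sum_congr rfl h2, hlead, h3] at hsum
  simp at hsum
  exact hcard hsum

/-- The powers `h ^ k`, `k < m`, of every `h ∈ G` are polynomial functions of degree less than `m`. -/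
def PowersHaveDegreeLT {p : ℕ} (G : Subgroup (Equiv.Perm (ZMod p))) (m : ℕ) : Prop :=
  ∀ h ∈ G, ∀ k < m, ∃ q : Polynomial (ZMod p), q.natDegree < m ∧ ∀ x, q.eval x = h x ^ k

open Polynomial in
lemma PowersHaveDegreeLT.sub {p : ℕ} [Fact p.Prime] {G : Subgroup (Equiv.Perm (ZMod p))} {m : ℕ}
    (hG : PowersHaveDegreeLT G m) (hmp : m < p) : PowersHaveDegreeLT G (p - m) := by
  intro g hg l hl
  obtain ⟨r, hr, hrg⟩ := exists_polynomial_eval_eq fun x => g x ^ l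
  refine ⟨r, ?_, hrg⟩
  by_contra! hdeg
  have hr0 : r ≠ 0 := by
    rintro rfl
    simp at hdeg
    omega
  obtain ⟨q, hq, hqg⟩ := hG g⁻¹ (G.inv_mem hg) (p - 1 - r.natDegree) (by omega)
  have h1 := sum_univ_eval_eq_neg_coeff (X ^ (p - 1 - r.natDegree) * r)
    (by rw [natDegree_X_pow_mul _ hr0]; omega)
  have hcoeff : (X ^ (p - 1 - r.natDegree) * r).coeff (p - 1) = r.leadingCoeff := by
    rw [coeff_X_pow_mul', if_pos (by omega)]
    congr 1
    omega
  have hlt : (q * X ^ l).natDegree < p - 1 := by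
    refine lt_of_le_of_lt natDegree_mul_le ?_
    rw [natDegree_X_pow]
    omega
  have h2 := sum_univ_eval_eq_neg_coeff (q * X ^ l) hlt.le
  rw [coeff_eq_zero_of_natDegree_lt hlt, neg_zero] at h2
  have h3 : ∑ x, (X ^ (p - 1 - r.natDegree) * r).eval x = ∑ x, (q * X ^ l).eval x := by
    refine Finset.sum_equiv g (by simp) fun x _ => ?_
    simp [hrg, hqg]
  rw [h3, h2, hcoeff] at h1
  exact leadingCoeff_ne_zero.2 hr0 (neg_eq_zero.1 h1.symm)

open Polynomial in
lemma mem_AGSetP_of_eval_eq {p : ℕ} [Fact p.Prime] (h : Equiv.Perm (ZMod p)) (f : (ZMod p)[X])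
    (hf : f.natDegree ≤ 1) (hfh : ∀ x, f.eval x = h x) : h ∈ AGSetP p := by
  have hh : ∀ x, h x = f.coeff 1 * x + f.coeff 0 := fun x => by
    rw [← hfh, eq_X_add_C_of_natDegree_le_one hf]
    simp
  refine ⟨f.coeff 1, f.coeff 0, fun h0 => ?_, hh⟩
  have : h 0 = h 1 := by rw [hh, hh, h0]; simp
  exact zero_ne_one (h.injective this)

open Polynomial in
lemma PowersHaveDegreeLT.subset_AGSetP {p : ℕ} [Fact p.Prime]
    {G : Subgroup (Equiv.Perm (ZMod p))} {m : ℕ} (hG : PowersHaveDegreeLT G m) (hm : 2 ≤ m)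
    (hmp : 2 * m ≤ p) : (G : Set (Equiv.Perm (ZMod p))) ⊆ AGSetP p := by
  intro h hh
  obtain ⟨f, hfm, hfh⟩ := hG h hh 1 (by omega)
  simp only [pow_one] at hfh
  refine mem_AGSetP_of_eval_eq h f ?_ hfh
  by_contra! hn
  have hex : ∃ k, m ≤ k * f.natDegree := ⟨m, by nlinarith⟩
  classical
  have hk := Nat.find_spec hex
  set k := Nat.find hex with hkdef
  obtain ⟨j, hj⟩ : ∃ j, k = j + 1 := by
    refine Nat.exists_eq_succ_of_ne_zero fun h0 => ?_
    rw [h0] at hk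
    omega
  have hjm : j * f.natDegree < m := not_le.1 (Nat.find_min hex (show j < Nat.find hex by omega))
  rw [hj] at hk
  obtain ⟨q, hq, hqh⟩ := hG h hh (j + 1) (by nlinarith)
  have hdeg : (f ^ (j + 1)).natDegree = (j + 1) * f.natDegree := natDegree_pow f (j + 1)
  have heq : f ^ (j + 1) = q := by
    refine polynomial_eq_of_eval_eq ?_ (by omega) fun x => by rw [eval_pow, hfh, hqh]
    rw [hdeg]
    linarith [add_one_mul j f.natDegree]
  rw [heq] at hdeg
  omega

open Polynomial in
/-- A group of permutations of `ZMod p` that preserves the relation `x - y ∈ U`, for a set `U` of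
nonzero residues that is neither empty nor everything, consists of affine maps. -/
lemma subset_AGSetP_of_sub_mem {p : ℕ} [Fact p.Prime] (G : Subgroup (Equiv.Perm (ZMod p)))
    (U : Finset (ZMod p)) (hne : U.Nonempty) (h0 : 0 ∉ U) {b : ZMod p} (hb : b ≠ 0) (hbU : b ∉ U)
    (hGU : ∀ h ∈ G, ∀ x, ∀ u ∈ U, h (x + u) - h x ∈ U) :
    (G : Set (Equiv.Perm (ZMod p))) ⊆ AGSetP p := by
  classical
  have hex := exists_power_sum_ne_zero U hne h0 hb hbU
  obtain ⟨hm, hmp, hUm⟩ := Nat.find_spec hex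
  set m := Nat.find hex with hmdef
  have hU : ∀ j, 0 < j → j < m → ∑ u ∈ U, u ^ j = 0 := fun j hj hjm => by
    by_contra hcon
    exact Nat.find_min hex hjm ⟨hj, by omega, hcon⟩
  have hperm : ∀ h ∈ G, ∀ x, ∀ F : ZMod p → ZMod p,
      ∑ u ∈ U, F (h (x + u)) = ∑ u ∈ U, F (u + h x) := fun h hh x F => by
    have hinj : Set.InjOn (fun u => h (x + u) - h x) U := fun u _ v _ huv => by
      simpa using huv
    have himg : U.image (fun u => h (x + u) - h x) = U :=
      Finset.eq_of_subset_of_card_le (Finset.image_subset_iff.2 (hGU h hh x))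
        (Finset.card_image_of_injOn hinj).ge
    conv_rhs => rw [← himg, Finset.sum_image hinj]
    simp
  have hpow : ∀ h ∈ G, ∀ k, 0 < k → k ≤ m → ∀ x, ∑ u ∈ U, h (x + u) ^ k =
      (U.card : ZMod p) * h x ^ k + if k = m then ∑ u ∈ U, u ^ m else 0 := fun h hh k hk hkm x => by
    rw [hperm h hh x (· ^ k)]
    have := sum_eval_eq_of_power_sums_eq_zero U hk (fun j hj hjk => hU j hj (by omega))
      ((X + C (h x)) ^ k) (by simp)
    have hlead : ((X + C (h x)) ^ k).coeff k = 1 := by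
      simpa using ((monic_X_add_C (h x)).pow k).coeff_natDegree
    simp only [hlead, coeff_zero_eq_eval_zero, eval_pow, eval_add, eval_X, eval_C, zero_add,
      mul_one] at this
    rw [this]
    split_ifs with hkm'
    · rw [hkm']
    · rw [hU k hk (by omega)]
  have hP : PowersHaveDegreeLT G m := fun h hh k hk => by
    obtain ⟨q, hq, hqh⟩ := exists_polynomial_eval_eq fun x => h x ^ k
    rcases Nat.eq_zero_or_pos k with rfl | hk0
    · exact ⟨1, by simpa using hm, by simp⟩
    refine ⟨q, ?_, hqh⟩
    by_contra! hqm
    refine (natDegree_eq_of_sum_eval_add_eq U hm hU hUm q hq 0 (fun x => ?_) hqm).2 rfl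
    simp only [hqh]
    rw [hpow h hh k hk0 hk.le, if_neg hk.ne]
  rcases Nat.lt_or_ge 1 m with hm1 | hm1
  · rcases le_total (2 * m) p with h2 | h2
    · exact hP.subset_AGSetP hm1 h2
    · exact (hP.sub (by omega)).subset_AGSetP (by omega) (by omega)
  · intro h hh
    obtain ⟨f, hf, hfh⟩ := exists_polynomial_eval_eq h
    refine mem_AGSetP_of_eval_eq h f ?_ hfh
    by_contra! hn
    have hfm : f.natDegree = m := by
      refine (natDegree_eq_of_sum_eval_add_eq U hm hU hUm f hf (∑ u ∈ U, u ^ m)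
        (fun x => ?_) (by omega)).1
      have := hpow h hh 1 one_pos hm x
      rw [if_pos (by omega)] at this
      simpa [hfh] using this
    omega

lemma zpow_addRight_one_apply {p : ℕ} (n : ℤ) (x : ZMod p) :
    (Equiv.addRight (1 : ZMod p) ^ n) x = x + n := by
  simp

/-- A group of permutations of `ZMod p` containing the translation by `1` which is not doubly
transitive consists of affine maps. -/
lemma subset_AGSetP_of_not_doubly_transitive {p : ℕ} [Fact p.Prime]
    (G : Subgroup (Equiv.Perm (ZMod p)))
    (hT : Equiv.addRight (1 : ZMod p) ∈ G)
    (hG : ¬ ∀ x₁ x₂ y₁ y₂ : ZMod p, x₁ ≠ x₂ → y₁ ≠ y₂ →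
      ∃ g ∈ G, (g : Equiv.Perm (ZMod p)) x₁ = y₁ ∧ (g : Equiv.Perm (ZMod p)) x₂ = y₂) :
    (G : Set (Equiv.Perm (ZMod p))) ⊆ AGSetP p := by
  classical
  push Not at hG
  obtain ⟨x₁, x₂, y₁, y₂, hx, hy, hG⟩ := hG
  have htrans : ∀ t : ZMod p, ∃ τ ∈ G, ∀ x, τ x = x + t := fun t => by
    obtain ⟨n, rfl⟩ := ZMod.intCast_surjective t
    exact ⟨_, G.zpow_mem hT n, zpow_addRight_one_apply n⟩
  refine subset_AGSetP_of_sub_mem G {d | ∃ g ∈ G, g x₁ - g x₂ = d} ⟨x₁ - x₂, ?_⟩ ?_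
    (sub_ne_zero.2 hy) ?_ ?_
  · simpa using ⟨1, G.one_mem, rfl⟩
  · simpa [sub_eq_zero] using fun _ _ => hx
  · simp only [Finset.mem_filter, Finset.mem_univ, true_and]
    rintro ⟨g, hg, hgd⟩
    obtain ⟨τ, hτ, hτx⟩ := htrans (y₂ - g x₂)
    refine hG (τ * g) (G.mul_mem hτ hg) ?_ ?_
    · rw [Equiv.Perm.mul_apply, hτx]
      linear_combination hgd
    · rw [Equiv.Perm.mul_apply, hτx]
      ring
  · simp only [Finset.mem_filter, Finset.mem_univ, true_and]
    rintro h hh x _ ⟨g, hg, rfl⟩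
    obtain ⟨τ, hτ, hτx⟩ := htrans (x - g x₂)
    refine ⟨h * (τ * g), G.mul_mem hh (G.mul_mem hτ hg), ?_⟩
    simp only [Equiv.Perm.mul_apply, hτx]
    congr 2 <;> ring_nf

/-- The slope homomorphism `x ↦ a * x + b` to `a` on a group of affine permutations. -/
def slopeHom {p : ℕ} (G : Subgroup (Equiv.Perm (ZMod p)))
    (hG : (G : Set (Equiv.Perm (ZMod p))) ⊆ AGSetP p) : G →* (ZMod p)ˣ :=
  MonoidHom.toHomUnits
    { toFun := fun g => g.1 1 - g.1 0
      map_one' := by simp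
      map_mul' := fun g h => by
        obtain ⟨a, b, -, hab⟩ := hG g.2
        simp only [Subgroup.coe_mul, Equiv.Perm.mul_apply, hab]
        ring }

lemma map_ker_slopeHom {p : ℕ} (G : Subgroup (Equiv.Perm (ZMod p)))
    (hG : (G : Set (Equiv.Perm (ZMod p))) ⊆ AGSetP p) (hT : Equiv.addRight (1 : ZMod p) ∈ G) :
    Subgroup.map G.subtype (slopeHom G hG).ker =
      Subgroup.zpowers (Equiv.addRight (1 : ZMod p)) := by
  apply le_antisymm
  · rintro _ ⟨g, hg, rfl⟩
    have hg' : g.1 1 - g.1 0 = 1 := congrArg Units.val (MonoidHom.mem_ker.1 hg)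
    obtain ⟨a, b, -, hab⟩ := hG g.2
    obtain ⟨n, hn⟩ := ZMod.intCast_surjective b
    refine ⟨n, Equiv.ext fun x => ?_⟩
    have ha : a = 1 := by simpa [hab] using hg'
    rw [G.coe_subtype, hab, ha, one_mul, ← hn]
    exact zpow_addRight_one_apply n x
  · rw [Subgroup.zpowers_le]
    refine ⟨⟨_, hT⟩, MonoidHom.mem_ker.2 (Units.ext ?_), rfl⟩
    change Equiv.addRight (1 : ZMod p) 1 - Equiv.addRight (1 : ZMod p) 0 = 1
    simp

lemma card_zpowers_addRight_one (p : ℕ) [Fact p.Prime] :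
    Nat.card (Subgroup.zpowers (Equiv.addRight (1 : ZMod p))) = p := by
  rw [Nat.card_zpowers]
  apply orderOf_eq_prime
  · ext x
    simp
  · intro h
    simpa using congrArg (fun f : Equiv.Perm (ZMod p) => f 0) h

/-- A transitive group of prime degree `p` containing the complete cycle `T` which is
not doubly transitive is contained in `AG(p)`, has order `p·m` with `m ∣ p - 1`,
has `⟨T⟩` as a normal Sylow `p`-subgroup, and is solvable. -/
theorem stmt_17 (p : ℕ) (hp : p.Prime)
    (G : Subgroup (Equiv.Perm (ZMod p)))
    (hT : Equiv.addRight (1 : ZMod p) ∈ G)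
    (hnot2trans : ¬ ∀ x₁ x₂ y₁ y₂ : ZMod p, x₁ ≠ x₂ → y₁ ≠ y₂ →
      ∃ g ∈ G, (g : Equiv.Perm (ZMod p)) x₁ = y₁ ∧ (g : Equiv.Perm (ZMod p)) x₂ = y₂) :
    (G : Set (Equiv.Perm (ZMod p))) ⊆ AGSetP p ∧
    (∃ m : ℕ, m ∣ p - 1 ∧ Nat.card G = p * m) ∧
    (∃ P : Sylow p G,
      Subgroup.map G.subtype P.toSubgroup =
        Subgroup.zpowers (Equiv.addRight (1 : ZMod p)) ∧ P.toSubgroup.Normal) ∧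
    IsSolvable G := by
  have : Fact p.Prime := ⟨hp⟩
  have hG := subset_AGSetP_of_not_doubly_transitive G hT hnot2trans
  have hker := map_ker_slopeHom G hG hT
  have hcard : Nat.card (slopeHom G hG).ker = p := by
    rw [← Subgroup.card_map_of_injective G.subtype_injective, hker, card_zpowers_addRight_one]
  have hindex : (slopeHom G hG).ker.index ∣ p - 1 := by
    rw [Subgroup.index_ker, ← ZMod.card_units p, ← Nat.card_eq_fintype_card]
    exact Subgroup.card_subgroup_dvd_card _
  have hndvd : ¬ p ∣ (slopeHom G hG).ker.index := fun h =>
    absurd (Nat.le_of_dvd (Nat.sub_pos_of_lt hp.one_lt) (h.trans hindex)) (by have := hp.pos; omega)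
  refine ⟨hG, ⟨_, hindex, ?_⟩,
    ⟨(IsPGroup.of_card (n := 1) (by rw [hcard, pow_one])).toSylow hndvd, ?_, ?_⟩, ?_⟩
  · rw [← Subgroup.card_mul_index (slopeHom G hG).ker, hcard]
  · rw [IsPGroup.toSylow_coe, hker]
  · rw [IsPGroup.toSylow_coe]
    infer_instance
  · have : IsCyclic (slopeHom G hG).ker := isCyclic_of_prime_card hcard
    have : IsMulCommutative (slopeHom G hG).ker := inferInstance
    exact Group.isSolvable_of_ker_le_range (slopeHom G hG).ker.subtype (slopeHom G hG) (by simp)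
end

section
/- Let p be a prime and let C be a cyclic code of length p over the field F_p = ZMod p which is non-elementary, i.e., C is not the zero code, not the full space, not the repetition code (the span of the all-ones word), and not the dual of the repetition code (the subspace of words whose coordinates sum to 0). Then Aut(C) = AG(p), the affine group of all permutations x ↦ a·x + b of ZMod p with a ≠ 0. -/
open Polynomial

/-- The code of words of length `p` given by polynomials of degree less than `d`. -/
noncomputable def polyCode (p : ℕ) [Fact p.Prime] (d : ℕ) :
    Submodule (ZMod p) (ZMod p → ZMod p) :=
  (degreeLT (ZMod p) d).map (LinearMap.pi fun x => leval x)

section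

variable {p : ℕ} [Fact p.Prime]

theorem mem_polyCode {d : ℕ} {c : ZMod p → ZMod p} :
    c ∈ polyCode p d ↔ ∃ f : (ZMod p)[X], f.degree < d ∧ ∀ x, f.eval x = c x := by
  simp only [polyCode, Submodule.mem_map, mem_degreeLT, funext_iff, LinearMap.pi_apply,
    leval_apply]

theorem sum_eval_eq_neg_coeff (f : (ZMod p)[X]) (hf : f.natDegree < p) :
    ∑ x, f.eval x = -f.coeff (p - 1) := by
  have hp : 0 < p := (Fact.out : p.Prime).pos
  simp only [eval_eq_sum_range' hf]
  rw [Finset.sum_comm, Finset.sum_eq_single (p - 1)]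
  · rw [← Finset.mul_sum]
    have h : ∑ x : ZMod p, x ^ (p - 1) = -1 := by
      rw [← Finset.add_sum_erase _ _ (Finset.mem_univ (0 : ZMod p)),
        Finset.sum_congr rfl fun x hx => ZMod.pow_card_sub_one_eq_one (Finset.ne_of_mem_erase hx),
        zero_pow (Nat.sub_ne_zero_of_lt (Fact.out : p.Prime).one_lt)]
      simp [Finset.card_erase_of_mem, ZMod.card, Nat.cast_sub hp]
    rw [h, mul_neg_one]
  · intro i hi hne
    rw [← Finset.mul_sum, FiniteField.sum_pow_lt_card_sub_one, mul_zero]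
    rw [ZMod.card]
    have := Finset.mem_range.1 hi
    omega
  · intro h
    exact absurd (Finset.mem_range.2 (by omega)) h

theorem mem_polyCode_card (c : ZMod p → ZMod p) : c ∈ polyCode p p := by
  classical
  refine mem_polyCode.2 ⟨Lagrange.interpolate Finset.univ id c, ?_, fun x => ?_⟩
  · simpa [ZMod.card] using
      Lagrange.degree_interpolate_lt (s := Finset.univ) c (Function.injective_id (α := ZMod p)).injOn
  · exact Lagrange.eval_interpolate_at_node (v := id) c Function.injective_id.injOn
      (Finset.mem_univ x)

theorem sum_eval_mul_pow_ne_zero {f : (ZMod p)[X]} (hf : f ≠ 0) (hn : f.natDegree < p) :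
    ∑ x, f.eval x * x ^ (p - 1 - f.natDegree) ≠ 0 := by
  have hd : (f * X ^ (p - 1 - f.natDegree)).natDegree = p - 1 := by
    rw [natDegree_mul_X_pow _ hf]
    omega
  have h := sum_eval_eq_neg_coeff (f * X ^ (p - 1 - f.natDegree)) (by omega)
  simp only [eval_mul, eval_pow, eval_X] at h
  rw [h, neg_ne_zero]
  nth_rw 2 [← hd]
  rw [coeff_natDegree, leadingCoeff_mul_X_pow]
  exact leadingCoeff_ne_zero.2 hf

/-- A word belongs to `polyCode p d` exactly when its first `p - d` moments vanish. -/
theorem mem_polyCode_iff_sum_eq_zero {d : ℕ} {c : ZMod p → ZMod p} :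
    c ∈ polyCode p d ↔ ∀ i, i + d < p → ∑ x, c x * x ^ i = 0 := by
  constructor
  · intro hc i hi
    obtain ⟨f, hf, hfc⟩ := mem_polyCode.1 hc
    rcases eq_or_ne f 0 with rfl | hf0
    · simp [← hfc]
    have hlt : f.natDegree < d := (natDegree_lt_iff_degree_lt hf0).2 hf
    have hd := natDegree_mul_X_pow i hf0
    have h := sum_eval_eq_neg_coeff (f * X ^ i) (by omega)
    rw [coeff_eq_zero_of_natDegree_lt (by omega), neg_zero] at h
    simpa [hfc] using h
  · intro h
    obtain ⟨f, hf, hfc⟩ := mem_polyCode.1 (mem_polyCode_card c)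
    refine mem_polyCode.2 ⟨f, ?_, hfc⟩
    rcases eq_or_ne f 0 with rfl | hf0
    · simp
    have hlt : f.natDegree < p := (natDegree_lt_iff_degree_lt hf0).2 hf
    rw [← natDegree_lt_iff_degree_lt hf0]
    by_contra! hle
    refine sum_eval_mul_pow_ne_zero hf0 hlt ?_
    simp only [hfc]
    exact h _ (by omega)

theorem polyCode_zero : polyCode p 0 = ⊥ := by
  refine (Submodule.eq_bot_iff _).2 fun c hc => ?_
  obtain ⟨f, hf, hfc⟩ := mem_polyCode.1 hc
  have hf0 : f = 0 := by
    rw [← degree_eq_bot]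
    exact Nat.WithBot.lt_zero_iff.1 (by simpa using hf)
  funext x
  simp [← hfc, hf0]

theorem polyCode_one : polyCode p 1 = Submodule.span (ZMod p) {fun _ => (1 : ZMod p)} := by
  ext c
  rw [mem_polyCode, Submodule.mem_span_singleton]
  constructor
  · rintro ⟨f, hf, hfc⟩
    refine ⟨f.coeff 0, ?_⟩
    have hf' : f = C (f.coeff 0) :=
      eq_C_of_degree_le_zero (Nat.WithBot.lt_one_iff_le_zero.1 (by simpa using hf))
    funext x
    rw [← hfc x, hf']
    simp
  · rintro ⟨a, rfl⟩
    refine ⟨C a, lt_of_le_of_lt degree_C_le (by simp), fun x => by simp⟩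

theorem polyCode_card_sub_one :
    (polyCode p (p - 1) : Set (ZMod p → ZMod p)) = {c | ∑ i, c i = 0} := by
  have hp : 0 < p := (Fact.out : p.Prime).pos
  ext c
  rw [SetLike.mem_coe, mem_polyCode_iff_sum_eq_zero, Set.mem_ofPred_eq]
  constructor
  · intro h
    simpa using h 0 (by omega)
  · intro h i hi
    obtain rfl : i = 0 := by omega
    simpa using h

theorem natDegree_taylor_sub_self {f : (ZMod p)[X]} {n : ℕ} (hf : f.natDegree = n + 1)
    (hn : n + 1 < p) {r : ZMod p} (hr : r ≠ 0) :
    taylor r f - f ≠ 0 ∧ (taylor r f - f).natDegree = n := by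
  have hcast : ((n + 1 : ℕ) : ZMod p) ≠ 0 := by
    rw [Ne, ZMod.natCast_eq_zero_iff]
    exact fun h => absurd (Nat.le_of_dvd (Nat.succ_pos n) h) (by omega)
  have hlead : f.coeff (n + 1) ≠ 0 := by
    rw [← hf, coeff_natDegree, leadingCoeff_ne_zero]
    rintro rfl
    simp at hf
  have hcoeff : (taylor r f - f).coeff n ≠ 0 := by
    have hd : (hasseDeriv n f).natDegree < 2 := by
      have := natDegree_hasseDeriv_le f n
      omega
    rw [coeff_sub, taylor_coeff, eval_eq_sum_range' hd]
    simp only [Finset.sum_range_succ, Finset.sum_range_zero, hasseDeriv_coeff]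
    rw [zero_add n, add_comm 1 n, Nat.choose_self, Nat.choose_succ_self_right]
    simpa using ⟨⟨by simpa using hcast, hlead⟩, hr⟩
  have hle : (taylor r f - f).natDegree ≤ n := by
    refine natDegree_le_iff_coeff_eq_zero.2 fun N hN => ?_
    rcases (Nat.succ_le_of_lt hN).eq_or_lt with h | h
    · have h1 := coeff_taylor_natDegree (r := r) (f := f)
      rw [hf] at h1
      rw [← h, coeff_sub, Nat.succ_eq_add_one, h1, ← hf, coeff_natDegree, sub_self]
    · refine coeff_eq_zero_of_natDegree_lt ((natDegree_sub_le _ _).trans_lt ?_)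
      rw [natDegree_taylor, max_self, hf]
      exact h
  exact ⟨fun h => hcoeff (by simp [h]), le_antisymm hle (le_natDegree_of_ne_zero hcoeff)⟩

theorem IsCyclicCode.eval_mem {D : Submodule (ZMod p) (ZMod p → ZMod p)} (hD : IsCyclicCode D)
    {n : ℕ} (hn : n < p) {f : (ZMod p)[X]} (hf0 : f ≠ 0) (hf : f.natDegree = n)
    (hfD : (fun x => f.eval x) ∈ D) {h : (ZMod p)[X]} (hh : h.natDegree ≤ n) :
    (fun x => h.eval x) ∈ D := by
  induction n generalizing f h with
  | zero =>
    have hlead : f.coeff 0 ≠ 0 := by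
      rwa [← hf, coeff_natDegree, leadingCoeff_ne_zero]
    rw [eq_C_of_natDegree_le_zero hf.le] at hfD
    rw [eq_C_of_natDegree_le_zero hh]
    convert D.smul_mem (h.coeff 0 / f.coeff 0) hfD using 1
    funext x
    simp [hlead]
  | succ n ih =>
    have hlead : f.coeff (n + 1) ≠ 0 := by
      rwa [← hf, coeff_natDegree, leadingCoeff_ne_zero]
    obtain ⟨h0, hdeg⟩ := natDegree_taylor_sub_self hf hn (r := -1) (neg_ne_zero.2 one_ne_zero)
    have hmem : (fun x => (taylor (-1) f - f).eval x) ∈ D := by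
      convert D.sub_mem (hD _ hfD) hfD using 1
      funext x
      simp [taylor_eval, sub_eq_add_neg, add_comm]
    set a := h.coeff (n + 1) / f.coeff (n + 1) with ha
    have hle : (h - C a * f).natDegree ≤ n := by
      refine natDegree_le_iff_coeff_eq_zero.2 fun N hN => ?_
      rcases (Nat.succ_le_of_lt hN).eq_or_lt with rfl | hlt
      · simp [ha, hlead]
      · rw [coeff_sub, coeff_C_mul, coeff_eq_zero_of_natDegree_lt (hh.trans_lt hlt),
          coeff_eq_zero_of_natDegree_lt (hf.trans_lt hlt), mul_zero, sub_zero]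
    convert D.add_mem (ih (by omega) h0 hdeg hmem hle) (D.smul_mem a hfD) using 1
    funext x
    simp

/-- Cyclic codes of length `p` over `ZMod p` are the codes `polyCode p d`. -/
theorem IsCyclicCode.exists_eq_polyCode {D : Submodule (ZMod p) (ZMod p → ZMod p)}
    (hD : IsCyclicCode D) : ∃ d ≤ p, D = polyCode p d := by
  classical
  have hex : ∃ d, D ≤ polyCode p d := ⟨p, fun c _ => mem_polyCode_card c⟩
  have hp : Nat.find hex ≤ p := Nat.find_min' hex fun c _ => mem_polyCode_card c
  refine ⟨Nat.find hex, hp, le_antisymm (Nat.find_spec hex) ?_⟩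
  rcases Nat.eq_zero_or_eq_succ_pred (Nat.find hex) with h0 | hs
  · rw [h0, polyCode_zero]
    exact bot_le
  set n := (Nat.find hex).pred
  obtain ⟨c, hcD, hc⟩ := SetLike.not_le_iff_exists.1 (Nat.find_min hex (m := n) (by omega))
  obtain ⟨f, hf, hfc⟩ := mem_polyCode.1 (Nat.find_spec hex hcD)
  have hf0 : f ≠ 0 := by
    rintro rfl
    exact hc (mem_polyCode.2 ⟨0, by simp, hfc⟩)
  have hlt := (natDegree_lt_iff_degree_lt hf0).2 hf
  have hge : n ≤ f.natDegree := by
    by_contra! hlt'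
    exact hc (mem_polyCode.2 ⟨f, (natDegree_lt_iff_degree_lt hf0).1 hlt', hfc⟩)
  intro e he
  obtain ⟨h, hh, hhe⟩ := mem_polyCode.1 he
  obtain rfl : (fun x => h.eval x) = e := funext hhe
  obtain rfl : (fun x => f.eval x) = c := funext hfc
  refine hD.eval_mem (n := n) (by omega) hf0 (by omega) hcD (natDegree_le_of_degree_le ?_)
  rw [hs] at hh
  exact Order.le_of_lt_succ hh

theorem exists_eq_affine_of_pow_mem_of_two_mul_le {d : ℕ} (hd : 2 ≤ d) (hdp : 2 * d ≤ p)
    (g : ZMod p → ZMod p) (hg : ∀ j < d, (fun x => g x ^ j) ∈ polyCode p d) :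
    ∃ a b : ZMod p, ∀ x, g x = a * x + b := by
  obtain ⟨G, hG, hGg⟩ := mem_polyCode.1 (hg 1 (by omega))
  simp only [pow_one] at hGg
  rcases le_or_gt G.natDegree 1 with hm | hm
  · refine ⟨G.coeff 1, G.coeff 0, fun x => ?_⟩
    rw [← hGg, eval_eq_sum_range' (Nat.lt_succ_of_le hm)]
    simp [Finset.sum_range_succ, add_comm]
  exfalso
  have hG0 : G ≠ 0 := by
    rintro rfl
    simp at hm
  have hlt : G.natDegree < d := (natDegree_lt_iff_degree_lt hG0).2 hG
  set m := G.natDegree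
  have hdiv : m * ((d - 1) / m) + (d - 1) % m = d - 1 := Nat.div_add_mod _ _
  have hmod : (d - 1) % m < m := Nat.mod_lt _ (by omega)
  have hq : 2 * ((d - 1) / m) ≤ m * ((d - 1) / m) := Nat.mul_le_mul_right _ hm
  have hj : (d - 1) / m + 1 < d := by omega
  have hdeg : (G ^ ((d - 1) / m + 1)).natDegree = m * ((d - 1) / m) + m := by
    rw [natDegree_pow]
    ring
  refine sum_eval_mul_pow_ne_zero (pow_ne_zero ((d - 1) / m + 1) hG0) (by omega) ?_
  simp only [eval_pow, hGg]
  exact mem_polyCode_iff_sum_eq_zero.1 (hg _ hj) _ (by omega)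

theorem pow_mem_polyCode_sub {d : ℕ} (hd : d ≤ p) (σ : Equiv.Perm (ZMod p))
    (hσ : ∀ j < d, (fun x => σ⁻¹ x ^ j) ∈ polyCode p d) :
    ∀ j < p - d, (fun x => σ x ^ j) ∈ polyCode p (p - d) := by
  intro j hj
  refine mem_polyCode_iff_sum_eq_zero.2 fun i hi => ?_
  rw [← Equiv.sum_comp σ⁻¹]
  have h := mem_polyCode_iff_sum_eq_zero.1 (hσ i (by omega)) j (by omega)
  simpa [mul_comm] using h

theorem comp_affine_mem_polyCode {d : ℕ} {c : ZMod p → ZMod p} (hc : c ∈ polyCode p d)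
    {a b : ZMod p} (ha : a ≠ 0) : (fun x => c (a * x + b)) ∈ polyCode p d := by
  obtain ⟨f, hf, hfc⟩ := mem_polyCode.1 hc
  refine mem_polyCode.2 ⟨f.comp (C a * X + C b), ?_, fun x => by simp [hfc]⟩
  rcases eq_or_ne f 0 with rfl | hf0
  · simp
  refine lt_of_le_of_lt degree_le_natDegree ?_
  rw [natDegree_comp, natDegree_linear ha, mul_one]
  exact_mod_cast (natDegree_lt_iff_degree_lt hf0).2 hf

theorem AGSetP_subset_autCode_polyCode (d : ℕ) :
    AGSetP p ⊆ (autCode (polyCode p d) : Set (Equiv.Perm (ZMod p))) := by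
  rintro σ ⟨a, b, ha, hσ⟩ c
  have hinv : ∀ x, σ⁻¹ x = a⁻¹ * x + -(a⁻¹ * b) := by
    intro x
    rw [Equiv.Perm.inv_eq_iff_eq, hσ]
    field_simp
    ring
  constructor
  · intro h
    have h' := comp_affine_mem_polyCode (b := b) h ha
    simpa [permAction, ← hσ] using h'
  · intro h
    have h' := comp_affine_mem_polyCode (b := -(a⁻¹ * b)) h (inv_ne_zero ha)
    simp only [← hinv] at h'
    exact h'

theorem pow_mem_polyCode_of_mem_autCode {d : ℕ} {σ : Equiv.Perm (ZMod p)}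
    (hσ : σ ∈ autCode (polyCode p d)) : ∀ j < d, (fun x => σ⁻¹ x ^ j) ∈ polyCode p d := by
  intro j hj
  refine (hσ fun x => x ^ j).2 (mem_polyCode.2 ⟨X ^ j, ?_, fun x => by simp⟩)
  rw [degree_X_pow]
  exact_mod_cast hj

theorem autCode_polyCode_subset_AGSetP {d : ℕ} (hd : 2 ≤ d) (hdp : d + 2 ≤ p) :
    (autCode (polyCode p d) : Set (Equiv.Perm (ZMod p))) ⊆ AGSetP p := by
  intro σ hσ
  have hinv := pow_mem_polyCode_of_mem_autCode hσ
  have hself := pow_mem_polyCode_of_mem_autCode (inv_mem hσ)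
  rw [inv_inv] at hself
  have haff : ∃ a b : ZMod p, ∀ x, σ x = a * x + b := by
    rcases le_total (2 * d) p with h | h
    · exact exists_eq_affine_of_pow_mem_of_two_mul_le hd h σ hself
    · exact exists_eq_affine_of_pow_mem_of_two_mul_le (by omega) (by omega) σ
        (pow_mem_polyCode_sub (by omega) σ hinv)
  obtain ⟨a, b, hab⟩ := haff
  refine ⟨a, b, ?_, hab⟩
  rintro rfl
  exact zero_ne_one (σ.injective (by simp [hab] : σ 0 = σ 1))

end

/-- A non-elementary cyclic code `C` of prime length `p` over `F_p = ZMod p` (not zero,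
not the full space, not the repetition code, not the dual of the repetition code)
has automorphism group exactly the affine group `AG(p)`. -/
theorem stmt_18 (p : ℕ) [Fact p.Prime]
    (C : Submodule (ZMod p) (ZMod p → ZMod p)) (hC : IsCyclicCode C)
    (h1 : C ≠ ⊥) (h2 : C ≠ ⊤)
    (h3 : C ≠ Submodule.span (ZMod p) {fun _ => (1 : ZMod p)})
    (h4 : (C : Set (ZMod p → ZMod p)) ≠ {c | ∑ i, c i = 0}) :
    (autCode C : Set (Equiv.Perm (ZMod p))) = AGSetP p := by
  obtain ⟨d, hd, rfl⟩ := hC.exists_eq_polyCode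
  have hd0 : d ≠ 0 := by
    rintro rfl
    exact h1 polyCode_zero
  have hd1 : d ≠ 1 := by
    rintro rfl
    exact h3 polyCode_one
  have hdp : d ≠ p := by
    rintro rfl
    exact h2 (eq_top_iff.2 fun c _ => mem_polyCode_card c)
  have hdp1 : d ≠ p - 1 := by
    rintro rfl
    exact h4 polyCode_card_sub_one
  exact (autCode_polyCode_subset_AGSetP (by omega) (by omega)).antisymm
    (AGSetP_subset_autCode_polyCode d)
end
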